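/- arXiv:2503.22700 — 3 statements merged into one kernel-verified Lean document; each statement's English description precedes it below -/
import Mathlib

section
/- Let y > 1 be a real number and suppose f(y) := limsup_{N→∞} f_N(y)/log N < ∞. Then δ_y > 0, i.e., the set {p + ⌊y^k⌋ : p prime, k a positive integer} has positive lower asymptotic density. Equivalently, 𝒴 ⊆ ℰ, where 𝒴 = {y > 1 : δ_y = 0} and ℰ = {y > 1 : f(y) = ∞}. -/
open MeasureTheory Filter

/-- `cnt N d a y` is the number of positive integers `k ≤ log N / log y`
with `⌊y^k⌋ ≡ a (mod d)`. -/
noncomputable def cnt (N d a : ℕ) (y : ℝ) : ℕ :=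
  Nat.card {k : ℕ | 1 ≤ k ∧ (k : ℝ) ≤ Real.log N / Real.log y ∧
    ⌊y ^ k⌋ ≡ (a : ℤ) [ZMOD (d : ℤ)]}

/-- `fN N y = Σ_{d=1}^{N} (1/d) · max_{1 ≤ a ≤ d} #{k ≥ 1 : k ≤ log N / log y,
⌊y^k⌋ ≡ a (mod d)}`. -/
noncomputable def fN (N : ℕ) (y : ℝ) : ℝ :=
  ∑ d ∈ Finset.Icc 1 N, (1 / (d : ℝ)) * (((Finset.Icc 1 d).sup (fun a => cnt N d a y) : ℕ) : ℝ)

/-- `f y = limsup_{N→∞} fN N y / log N`, with values in `[0, ∞]`. -/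
noncomputable def f (y : ℝ) : ENNReal :=
  Filter.limsup (fun N : ℕ => ENNReal.ofReal (fN N y / Real.log N)) Filter.atTop

/-- `Sy y` is the set of natural numbers of the form `p + ⌊y^k⌋` with `p` prime and
`k` a positive integer. -/
def Sy (y : ℝ) : Set ℕ :=
  {n : ℕ | ∃ p k : ℕ, p.Prime ∧ 1 ≤ k ∧ (n : ℤ) = (p : ℤ) + ⌊y ^ k⌋}

/-- `delta y` is the lower asymptotic density of `Sy y`. -/
noncomputable def delta (y : ℝ) : ℝ :=
  Filter.liminf (fun N : ℕ =>
    (Nat.card {n : ℕ | n ∈ Sy y ∧ n ∈ Set.Icc 1 N} : ℝ) / (N : ℝ)) Filter.atTop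


namespace Rom
open Finset

/-- number of roots of `n(n+h)` modulo `d`. -/
def rho (h d : ℕ) : ℕ := #{n ∈ range d | d ∣ n * (n + h)}

lemma rho_le (h d : ℕ) : rho h d ≤ d := by
  unfold rho
  exact (card_filter_le _ _).trans (by simp)

lemma dvd_mod_iff (h d n : ℕ) : d ∣ (n % d) * (n % d + h) ↔ d ∣ n * (n + h) := by
  apply Nat.ModEq.dvd_iff _ dvd_rfl
  exact Nat.ModEq.mul (Nat.mod_modEq _ _) (Nat.ModEq.add_right _ (Nat.mod_modEq _ _))

lemma rho_one (h : ℕ) : rho h 1 = 1 := by simp [rho]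

lemma rho_pos (h d : ℕ) (hd : 0 < d) : 0 < rho h d := by
  unfold rho
  apply card_pos.mpr
  exact ⟨0, by simp [hd]⟩

lemma rho_mul (h m n : ℕ) (hm : m ≠ 0) (hn : n ≠ 0) (hmn : m.Coprime n) :
    rho h (m * n) = rho h m * rho h n := by
  unfold rho
  rw [← card_product]
  apply card_nbij (fun a => (a % m, a % n))
  · intro a ha
    simp only [mem_filter, mem_range, mem_product, coe_filter, Set.mem_ofPred_eq] at ha ⊢
    simp only [coe_product, coe_filter, Set.mem_prod, Set.mem_ofPred_eq, mem_range]
    refine ⟨⟨Nat.mod_lt _ (by omega), ?_⟩, ⟨Nat.mod_lt _ (by omega), ?_⟩⟩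
    · rw [dvd_mod_iff]; exact (dvd_mul_right _ _).trans ha.2
    · rw [dvd_mod_iff]; exact (dvd_mul_left _ _).trans ha.2
  · intro a ha b hb hab
    simp only [mem_filter, mem_range, coe_filter, Set.mem_ofPred_eq, Prod.mk.injEq] at ha hb hab
    have : a ≡ b [MOD m * n] := (Nat.modEq_and_modEq_iff_modEq_mul hmn).1 hab
    exact Nat.ModEq.eq_of_lt_of_lt this ha.1 hb.1
  · rintro ⟨a, b⟩ hab
    simp only [coe_product, coe_filter, Set.mem_prod, Set.mem_ofPred_eq, mem_range] at hab
    obtain ⟨⟨ha, ha'⟩, hb, hb'⟩ := hab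
    have h1 := (Nat.chineseRemainder hmn a b).2
    have h2 := Nat.chineseRemainder_lt_mul hmn a b hm hn
    set c : ℕ := (Nat.chineseRemainder hmn a b).1 with hc
    have e1 : c % m = a := by rw [← Nat.mod_eq_of_lt ha]; exact h1.1
    have e2 : c % n = b := by rw [← Nat.mod_eq_of_lt hb]; exact h1.2
    refine ⟨c, ?_, by simp [e1, e2]⟩
    simp only [mem_filter, mem_range, coe_filter, Set.mem_ofPred_eq]
    refine ⟨h2, ?_⟩
    apply hmn.mul_dvd_of_dvd_of_dvd
    · rw [← dvd_mod_iff, e1]; exact ha'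
    · rw [← dvd_mod_iff, e2]; exact hb'

lemma rho_prime_dvd (h p : ℕ) (hp : p.Prime) (hph : p ∣ h) : rho h p = 1 := by
  unfold rho
  rw [card_eq_one]
  refine ⟨0, ?_⟩
  ext n
  simp only [mem_filter, mem_range, mem_singleton, hp.dvd_mul]
  constructor
  · rintro ⟨h1, h2⟩
    have : p ∣ n := by
      rcases h2 with h2 | h2
      · exact h2
      · exact (Nat.dvd_add_left hph).1 h2
    exact Nat.eq_zero_of_dvd_of_lt this h1
  · rintro rfl; simp [hp.pos]

lemma rho_prime_not_dvd (h p : ℕ) (hp : p.Prime) (hph : ¬ p ∣ h) : rho h p = 2 := by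
  unfold rho
  rw [card_eq_two]
  have h1 : h % p < p := Nat.mod_lt _ hp.pos
  have h2 : h % p ≠ 0 := fun h' => hph (Nat.dvd_of_mod_eq_zero h')
  refine ⟨0, p - h % p, by omega, ?_⟩
  ext n
  simp only [mem_filter, mem_range, mem_insert, mem_singleton, hp.dvd_mul]
  have key : p ∣ n + h ↔ p ∣ n + h % p := by
    apply Nat.ModEq.dvd_iff _ dvd_rfl
    exact Nat.ModEq.add_left _ (Nat.mod_modEq _ _).symm
  rw [key]
  constructor
  · rintro ⟨h3, h4 | h4⟩
    · left; exact Nat.eq_zero_of_dvd_of_lt h4 h3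
    · right
      have : n + h % p = p := by
        obtain ⟨c, hc⟩ := h4
        have hc1 : c < 2 := by
          by_contra hcc
          have : p * 2 ≤ p * c := Nat.mul_le_mul_left _ (by omega)
          omega
        have hc2 : c ≠ 0 := by rintro rfl; omega
        have : c = 1 := by omega
        subst this; omega
      omega
  · rintro (rfl | rfl)
    · simp [hp.pos]
    · refine ⟨by omega, Or.inr ?_⟩
      rw [Nat.sub_add_cancel h1.le]

lemma count_block (h d q r : ℕ) :
    Nat.count (fun n => d ∣ n * (n + h)) (d * q + r) =
      q * rho h d + Nat.count (fun n => d ∣ n * (n + h)) r := by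
  have step : ∀ m, Nat.count (fun n => d ∣ n * (n + h)) (d + m) =
      rho h d + Nat.count (fun n => d ∣ n * (n + h)) m := by
    intro m
    rw [Nat.count_add, Nat.count_eq_card_filter_range]
    congr 1
    congr 1
    ext n
    rw [← dvd_mod_iff h d (d + n), ← dvd_mod_iff h d n, Nat.add_mod_left]
  induction q with
  | zero => simp
  | succ q ih =>
    have : d * (q + 1) + r = d + (d * q + r) := by ring
    rw [this, step, ih]; ring

lemma count_bound (h d N : ℕ) (hd : 0 < d) :
    |((#{n ∈ range N | d ∣ n * (n + h)} : ℕ) : ℝ) - (rho h d : ℝ) / d * N| ≤ d := by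
  rw [← Nat.count_eq_card_filter_range]
  have e := count_block h d (N / d) (N % d)
  rw [Nat.div_add_mod] at e
  have h1 : Nat.count (fun n => d ∣ n * (n + h)) (N % d) ≤ rho h d := by
    rw [Nat.count_eq_card_filter_range]
    unfold rho
    apply card_le_card
    apply filter_subset_filter
    exact range_subset_range.2 (Nat.mod_lt _ hd).le
  set c := Nat.count (fun n => d ∣ n * (n + h)) (N % d)
  have h2 : (rho h d : ℝ) ≤ d := by exact_mod_cast rho_le h d
  have h3 : (c : ℝ) ≤ rho h d := by exact_mod_cast h1
  have h4 : (N : ℝ) = d * (N / d : ℕ) + (N % d : ℕ) := by exact_mod_cast (Nat.div_add_mod N d).symm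
  have hd' : (0 : ℝ) < d := by exact_mod_cast hd
  have h5 : ((N % d : ℕ) : ℝ) ≤ d := by exact_mod_cast (Nat.mod_lt _ hd).le
  have h6 : (rho h d : ℝ) / d * N = (N / d : ℕ) * rho h d + rho h d * ((N % d : ℕ) / d) := by
    generalize ((N / d : ℕ) : ℝ) = u at h4 ⊢
    generalize ((N % d : ℕ) : ℝ) = v at h4 ⊢
    rw [h4]; field_simp
  have h7 : (((N % d : ℕ) : ℝ) / d) ≤ 1 := by rw [div_le_one hd']; exact h5
  have h8 : 0 ≤ (((N % d : ℕ) : ℝ) / d) := by positivity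
  rw [e, h6, abs_le]
  have h9 : (rho h d : ℝ) * (((N % d : ℕ) : ℝ) / d) ≤ rho h d :=
    mul_le_of_le_one_right (by positivity) h7
  have h10 : 0 ≤ (rho h d : ℝ) * (((N % d : ℕ) : ℝ) / d) := by positivity
  have h11 : (0 : ℝ) ≤ c := by positivity
  push_cast
  constructor <;> linarith

/-- the density function -/
noncomputable def nu (h : ℕ) : ArithmeticFunction ℝ := ⟨fun d => (rho h d : ℝ) / d, by simp⟩

lemma nu_apply (h d : ℕ) : nu h d = (rho h d : ℝ) / d := rfl

lemma nu_mult (h : ℕ) : (nu h).IsMultiplicative := by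
  rw [ArithmeticFunction.IsMultiplicative.iff_ne_zero]
  refine ⟨by simp [nu_apply, rho_one], ?_⟩
  intro m n hm hn hmn
  simp only [nu_apply, rho_mul h m n hm hn hmn]
  push_cast
  field_simp

end Rom
namespace Rom
open Finset ArithmeticFunction BoundingSieve
open scoped ArithmeticFunction.Moebius

lemma sum_moebius_div (n : ℕ) :
    ∑ d ∈ n.divisors, μ (n / d) = if n = 1 then 1 else 0 := by
  rw [Nat.sum_div_divisors n (fun d => μ d)]
  have := congrArg (fun F : ArithmeticFunction ℤ => F n) moebius_mul_coe_zeta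
  simp only [mul_comm (μ) _, coe_zeta_mul_apply, one_apply] at this
  exact this

lemma inner_moebius (P l m : ℕ) (hP : P ≠ 0) (hm : m ∣ P) (hl : l ∣ P) :
    ∑ d ∈ P.divisors, (if l ∣ d ∧ d ∣ m then (μ (m / d) : ℝ) else 0) =
      if l = m then 1 else 0 := by
  have hm0 : m ≠ 0 := ne_zero_of_dvd_ne_zero hP hm
  have hl0 : l ≠ 0 := ne_zero_of_dvd_ne_zero hP hl
  by_cases hlm : l ∣ m
  · obtain ⟨e, rfl⟩ := hlm
    have he : e ≠ 0 := by rintro rfl; simp at hm0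
    have : ∑ d ∈ P.divisors, (if l ∣ d ∧ d ∣ l * e then (μ (l * e / d) : ℝ) else 0) =
        ∑ d ∈ e.divisors, (μ (e / d) : ℝ) := by
      rw [← sum_filter]
      symm
      apply sum_nbij (fun d => l * d)
      · intro d hd
        simp only [Nat.mem_divisors, mem_filter] at hd ⊢
        refine ⟨⟨(mul_dvd_mul_left l hd.1).trans hm, hP⟩, dvd_mul_right _ _, mul_dvd_mul_left l hd.1⟩
      · intro a _ b _ hab
        exact Nat.eq_of_mul_eq_mul_left (Nat.pos_of_ne_zero hl0) hab
      · intro d hd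
        simp only [coe_filter, Nat.mem_divisors, Set.mem_ofPred_eq] at hd
        obtain ⟨_, ⟨c, rfl⟩, h2⟩ := hd
        refine ⟨c, ?_, rfl⟩
        simp only [mem_coe, Nat.mem_divisors]
        exact ⟨Nat.dvd_of_mul_dvd_mul_left (Nat.pos_of_ne_zero hl0) h2, he⟩
      · intro d hd
        rw [Nat.mul_div_mul_left _ _ (Nat.pos_of_ne_zero hl0)]
    rw [this]
    have h2 := sum_moebius_div e
    have h3 : ∑ d ∈ e.divisors, (μ (e / d) : ℝ) = ((∑ d ∈ e.divisors, μ (e / d) : ℤ) : ℝ) := by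
      push_cast; rfl
    rw [h3, h2]
    have : (l = l * e) ↔ e = 1 := by
      constructor
      · intro h; exact Nat.eq_of_mul_eq_mul_left (Nat.pos_of_ne_zero hl0) (by omega)
      · rintro rfl; simp
    simp only [this]
    split_ifs <;> simp
  · rw [if_neg (by rintro rfl; exact hlm dvd_rfl)]
    apply sum_eq_zero
    intro d _
    rw [if_neg]
    rintro ⟨h1, h2⟩
    exact hlm (h1.trans h2)

variable (s : BoundingSieve) (z : ℕ)

/-- Selberg's normalising sum -/
noncomputable def G : ℝ := ∑ l ∈ s.prodPrimes.divisors with l ≤ z, s.selbergTerms l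

/-- diagonalised weights -/
noncomputable def yv (l : ℕ) : ℝ := if l ≤ z then (μ l : ℝ) * s.selbergTerms l / G s z else 0

/-- Selberg weights -/
noncomputable def w (d : ℕ) : ℝ :=
  (s.nu d)⁻¹ * ∑ l ∈ s.prodPrimes.divisors, if d ∣ l then (μ (l / d) : ℝ) * yv s z l else 0

variable {s z}

lemma one_mem_div : 1 ∈ s.prodPrimes.divisors := by
  simp [prodPrimes_ne_zero]

lemma G_pos (hz : 1 ≤ z) : 0 < G s z := by
  unfold G
  apply sum_pos
  · intro l hl
    simp only [mem_filter, Nat.mem_divisors] at hl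
    exact selbergTerms_pos hl.1.1
  · exact ⟨1, by simp [prodPrimes_ne_zero, hz]⟩

lemma w_inv {l : ℕ} (hl : l ∣ s.prodPrimes) :
    (∑ d ∈ s.prodPrimes.divisors, if l ∣ d then s.nu d * w s z d else 0) = yv s z l := by
  have hP : s.prodPrimes ≠ 0 := prodPrimes_ne_zero
  have h1 : (∑ d ∈ s.prodPrimes.divisors, if l ∣ d then s.nu d * w s z d else 0) =
      ∑ d ∈ s.prodPrimes.divisors, ∑ m ∈ s.prodPrimes.divisors,
        yv s z m * (if l ∣ d ∧ d ∣ m then (μ (m / d) : ℝ) else 0) := by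
    apply sum_congr rfl
    intro d hd
    have hd' := Nat.dvd_of_mem_divisors hd
    unfold w
    rw [mul_inv_cancel_left₀ (nu_ne_zero hd')]
    by_cases hld : l ∣ d
    · simp only [hld, if_true, true_and]
      apply sum_congr rfl
      intro m _
      split_ifs <;> ring
    · simp [hld]
  rw [h1, sum_comm]
  simp_rw [← mul_sum]
  rw [sum_congr rfl (fun m hm => by
    rw [inner_moebius s.prodPrimes l m hP (Nat.dvd_of_mem_divisors hm) hl])]
  simp [hl, hP]

lemma moebius_sq {l : ℕ} (hl : l ∣ s.prodPrimes) : (μ l : ℝ) * μ l = 1 := by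
  have h := moebius_sq_eq_one_of_squarefree (squarefree_of_dvd_prodPrimes hl)
  have : ((μ l : ℤ) : ℝ) ^ 2 = 1 := by exact_mod_cast h
  rw [← sq]; exact this

lemma w_one (hz : 1 ≤ z) : w s z 1 = 1 := by
  unfold w yv
  have h1 : s.nu 1 = 1 := s.nu_mult.1
  rw [h1]
  simp only [inv_one, one_mul, one_dvd, if_true, Nat.div_one]
  have : ∀ l ∈ s.prodPrimes.divisors, (μ l : ℝ) * (if l ≤ z then (μ l : ℝ) * s.selbergTerms l / G s z else 0)
     = if l ≤ z then s.selbergTerms l / G s z else 0 := by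
    intro l hl
    split_ifs
    · rw [mul_div_assoc, ← mul_assoc, moebius_sq (Nat.dvd_of_mem_divisors hl), one_mul]
    · simp
  rw [sum_congr rfl this, ← sum_filter, ← sum_div]
  exact div_self (G_pos hz).ne'

lemma main_eq (hz : 1 ≤ z) : s.mainSum (lambdaSquared (w s z)) = (G s z)⁻¹ := by
  rw [mainSum_lambdaSquared_eq_sum_mul_sum_sq]
  have : ∀ l ∈ s.prodPrimes.divisors, (s.selbergTerms l)⁻¹ *
        (∑ d ∈ s.prodPrimes.divisors, if l ∣ d then s.nu d * w s z d else 0) ^ 2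
      = if l ≤ z then s.selbergTerms l / (G s z) ^ 2 else 0 := by
    intro l hl
    have hl' := Nat.dvd_of_mem_divisors hl
    rw [w_inv hl']
    unfold yv
    have hg := (selbergTerms_pos hl').ne'
    have hm := moebius_sq hl'
    split_ifs
    · rw [div_pow, mul_pow, sq (μ l : ℝ), hm]
      field_simp
    · simp
  rw [sum_congr rfl this, ← sum_filter, ← sum_div]
  have := (G_pos (s := s) hz).ne'
  change G s z / (G s z) ^ 2 = _
  field_simp

lemma abs_yv_le (hz : 1 ≤ z) (l : ℕ) (hl : l ∣ s.prodPrimes) :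
    |yv s z l| ≤ if l ≤ z then s.selbergTerms l / G s z else 0 := by
  unfold yv
  have h1 := selbergTerms_pos hl
  have h2 := G_pos (s := s) hz
  split_ifs
  · rw [abs_div, abs_mul, abs_of_pos h1, abs_of_pos h2]
    gcongr
    have : |(μ l : ℝ)| ≤ 1 := by exact_mod_cast abs_moebius_le_one
    exact mul_le_of_le_one_left h1.le this
  · simp

lemma w_zero (d : ℕ) (hd : z < d) : w s z d = 0 := by
  unfold w yv
  rw [sum_eq_zero, mul_zero]
  intro l hl
  split_ifs with h1 h2
  · have := Nat.le_of_dvd (Nat.pos_of_mem_divisors hl) h1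
    omega
  · simp
  · rfl

lemma abs_w_le (hz : 1 ≤ z) (d : ℕ) (hd : d ∣ s.prodPrimes) : |w s z d| ≤ (s.nu d)⁻¹ := by
  unfold w
  have h0 := nu_pos_of_dvd_prodPrimes hd
  rw [abs_mul, abs_of_pos (inv_pos.2 h0)]
  apply mul_le_of_le_one_right (inv_pos.2 h0).le
  calc _ ≤ ∑ l ∈ s.prodPrimes.divisors, |if d ∣ l then (μ (l / d) : ℝ) * yv s z l else 0| :=
        abs_sum_le_sum_abs _ _
    _ ≤ ∑ l ∈ s.prodPrimes.divisors, if l ≤ z then s.selbergTerms l / G s z else 0 := by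
        apply sum_le_sum
        intro l hl
        have hl' := Nat.dvd_of_mem_divisors hl
        have h3 := abs_yv_le (s := s) hz l hl'
        by_cases h1 : d ∣ l
        · rw [if_pos h1, abs_mul]
          have : |(μ (l / d) : ℝ)| ≤ 1 := by exact_mod_cast abs_moebius_le_one
          exact (mul_le_of_le_one_left (abs_nonneg _) this).trans h3
        · rw [if_neg h1, abs_zero]; exact (abs_nonneg _).trans h3
    _ = 1 := by
        rw [← sum_filter, ← sum_div]
        exact div_self (G_pos hz).ne'

lemma err_le (hz : 1 ≤ z) (hnu : ∀ d, d ∣ s.prodPrimes → (s.nu d)⁻¹ ≤ d)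
    (hrem : ∀ d, d ∣ s.prodPrimes → |s.rem d| ≤ d) :
    s.errSum (lambdaSquared (w s z)) ≤ (z : ℝ) ^ 6 := by
  have hP : s.prodPrimes ≠ 0 := prodPrimes_ne_zero
  have hw : ∀ d, d ∣ s.prodPrimes → |w s z d| ≤ if d ≤ z then (z : ℝ) else 0 := by
    intro d hd
    split_ifs with h
    · exact ((abs_w_le hz d hd).trans (hnu d hd)).trans (by exact_mod_cast h)
    · rw [w_zero d (by omega), abs_zero]
  calc s.errSum (lambdaSquared (w s z)) ≤
      ∑ d ∈ s.prodPrimes.divisors, ∑ d1 ∈ s.prodPrimes.divisors, ∑ d2 ∈ s.prodPrimes.divisors,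
        if d = Nat.lcm d1 d2 then |w s z d1| * |w s z d2| * |s.rem d| else 0 := by
        unfold errSum lambdaSquared
        apply sum_le_sum
        intro d hd
        have hd' := Nat.dvd_of_mem_divisors hd
        have hsub := Nat.divisors_subset_of_dvd hP hd'
        calc _ ≤ (∑ d1 ∈ d.divisors, ∑ d2 ∈ d.divisors,
                if d = Nat.lcm d1 d2 then |w s z d1| * |w s z d2| else 0) * |s.rem d| := by
              gcongr
              refine (abs_sum_le_sum_abs _ _).trans (sum_le_sum fun d1 _ => ?_)
              refine (abs_sum_le_sum_abs _ _).trans (sum_le_sum fun d2 _ => ?_)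
              split_ifs
              · rw [abs_mul]
              · simp
          _ = ∑ d1 ∈ d.divisors, ∑ d2 ∈ d.divisors,
                if d = Nat.lcm d1 d2 then |w s z d1| * |w s z d2| * |s.rem d| else 0 := by
              simp_rw [sum_mul, ite_mul, zero_mul]
          _ ≤ ∑ d1 ∈ d.divisors, ∑ d2 ∈ s.prodPrimes.divisors,
                if d = Nat.lcm d1 d2 then |w s z d1| * |w s z d2| * |s.rem d| else 0 := by
              apply sum_le_sum
              intro d1 _
              apply sum_le_sum_of_subset_of_nonneg hsub
              intros; split_ifs <;> positivity
          _ ≤ _ := by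
              apply sum_le_sum_of_subset_of_nonneg hsub
              intros; apply sum_nonneg; intros; split_ifs <;> positivity
    _ = ∑ d1 ∈ s.prodPrimes.divisors, ∑ d2 ∈ s.prodPrimes.divisors,
          |w s z d1| * |w s z d2| * |s.rem (Nat.lcm d1 d2)| := by
        rw [sum_comm]
        apply sum_congr rfl
        intro d1 hd1
        rw [sum_comm]
        apply sum_congr rfl
        intro d2 hd2
        rw [sum_ite_eq_of_mem']
        rw [Nat.mem_divisors, Nat.lcm_dvd_iff]
        exact ⟨⟨Nat.dvd_of_mem_divisors hd1, Nat.dvd_of_mem_divisors hd2⟩, hP⟩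
    _ ≤ ∑ d1 ∈ s.prodPrimes.divisors, ∑ d2 ∈ s.prodPrimes.divisors,
          (if d1 ≤ z then 1 else 0) * (if d2 ≤ z then 1 else 0) * (z : ℝ) ^ 4 := by
        apply sum_le_sum
        intro d1 hd1
        apply sum_le_sum
        intro d2 hd2
        have hd1' := Nat.dvd_of_mem_divisors hd1
        have hd2' := Nat.dvd_of_mem_divisors hd2
        have h1 := hw d1 hd1'
        have h2 := hw d2 hd2'
        have h3 := hrem (Nat.lcm d1 d2) (Nat.lcm_dvd hd1' hd2')
        have h4 : Nat.lcm d1 d2 ≤ d1 * d2 :=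
          Nat.le_of_dvd (Nat.mul_pos (Nat.pos_of_mem_divisors hd1) (Nat.pos_of_mem_divisors hd2))
            (Nat.lcm_dvd_mul _ _)
        by_cases c1 : d1 ≤ z
        · by_cases c2 : d2 ≤ z
          · simp only [c1, c2, if_true] at h1 h2 ⊢
            have h5 : ((Nat.lcm d1 d2 : ℕ) : ℝ) ≤ z * z := by
              exact_mod_cast h4.trans (Nat.mul_le_mul c1 c2)
            calc _ ≤ (z : ℝ) * z * (z * z) := by
                  gcongr
                  exact h3.trans h5
              _ = _ := by ring
          · rw [w_zero d2 (by omega)]; simp [c2]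
        · rw [w_zero d1 (by omega)]; simp [c1]
    _ = (∑ d1 ∈ s.prodPrimes.divisors, if d1 ≤ z then (1 : ℝ) else 0) ^ 2 * (z : ℝ) ^ 4 := by
        simp_rw [← sum_mul, ← mul_sum]
        rw [← sum_mul]; ring
    _ ≤ (z : ℝ) ^ 2 * z ^ 4 := by
        gcongr
        rw [← sum_filter, sum_const, nsmul_eq_mul, mul_one]
        have : #{d ∈ s.prodPrimes.divisors | d ≤ z} ≤ #(Icc 1 z) := by
          apply card_le_card
          intro d hd
          simp only [mem_filter, mem_Icc] at hd ⊢
          exact ⟨Nat.pos_of_mem_divisors hd.1, hd.2⟩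
        rw [Nat.card_Icc] at this
        exact_mod_cast this
    _ = _ := by ring

theorem selberg (hz : 1 ≤ z) (hX : 0 ≤ s.totalMass) (hnu : ∀ d, d ∣ s.prodPrimes → (s.nu d)⁻¹ ≤ d)
    (hrem : ∀ d, d ∣ s.prodPrimes → |s.rem d| ≤ d) :
    s.siftedSum ≤ s.totalMass * (G s z)⁻¹ + (z : ℝ) ^ 6 := by
  have h := siftedSum_le_mainSum_errSum_of_upperMoebius (s := s) _
    (upperMoebius_lambdaSquared (w s z) (w_one hz))
  rw [main_eq hz] at h
  linarith [err_le (s := s) hz hnu hrem]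

end Rom
namespace Rom
open Finset

lemma sum_le_sum_inj {α β : Type*} [DecidableEq β] (s : Finset α) (t : Finset β) (i : α → β)
    (F : α → ℝ) (g : β → ℝ) (hi : ∀ a ∈ s, i a ∈ t) (hinj : Set.InjOn i s)
    (hfg : ∀ a ∈ s, F a ≤ g (i a)) (hg : ∀ b ∈ t, 0 ≤ g b) : ∑ a ∈ s, F a ≤ ∑ b ∈ t, g b := by
  calc ∑ a ∈ s, F a ≤ ∑ a ∈ s, g (i a) := sum_le_sum hfg
    _ = ∑ b ∈ s.image i, g b := (sum_image hinj).symm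
    _ ≤ _ := by
      apply sum_le_sum_of_subset_of_nonneg
      · intro b hb
        obtain ⟨a, ha, rfl⟩ := mem_image.1 hb
        exact hi a ha
      · intro b hb _; exact hg b hb

/-- odd squarefree numbers up to `z` -/
def D (z : ℕ) : Finset ℕ := {l ∈ Icc 1 z | Odd l ∧ Squarefree l}

lemma mem_D {z l : ℕ} : l ∈ D z ↔ (1 ≤ l ∧ l ≤ z) ∧ Odd l ∧ Squarefree l := by
  simp [D]

lemma rho_gcd (h : ℕ) : ∀ l : ℕ, Squarefree l →
    rho h l * #(Nat.gcd l h).divisors = #l.divisors := by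
  intro l
  induction l using Nat.strong_induction_on with
  | _ l ih =>
    intro hl
    rcases eq_or_ne l 1 with rfl | h1
    · simp [rho_one]
    · have hp := Nat.minFac_prime h1
      obtain ⟨m, hm⟩ := Nat.minFac_dvd l
      set p := l.minFac
      have hl0 := hl.ne_zero
      have hm0 : m ≠ 0 := by rintro rfl; simp at hm; exact hl0 hm
      have hsq := hl
      rw [hm, Nat.squarefree_mul_iff] at hsq
      have hlt : m < l := by
        rw [hm]
        exact lt_mul_of_one_lt_left (Nat.pos_of_ne_zero hm0) hp.one_lt
      have ih' := ih m hlt hsq.2.2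
      have hcop := hsq.1
      rw [hm, rho_mul h p m hp.ne_zero hm0 hcop, hcop.card_divisors_mul, Nat.gcd_comm,
        hcop.gcd_mul, Nat.Coprime.card_divisors_mul, Nat.gcd_comm h m, ← ih']
      · have hdp : #p.divisors = 2 := by
          rw [hp.divisors]; exact card_pair hp.one_lt.ne
        by_cases hph : p ∣ h
        · rw [Nat.gcd_eq_right hph, rho_prime_dvd h p hp hph, hdp]; ring
        · have : Nat.gcd h p = 1 := by
            rw [Nat.gcd_comm]; exact (Nat.Prime.coprime_iff_not_dvd hp).2 hph
          rw [this, rho_prime_not_dvd h p hp hph, hdp]; simp; ring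
      · exact Nat.Coprime.coprime_dvd_left (Nat.gcd_dvd_right _ _)
          (Nat.Coprime.coprime_dvd_right (Nat.gcd_dvd_right _ _) hcop)

lemma rho_div (h l m : ℕ) (hl : Squarefree l) (hml : m ∣ l) (hmh : m ∣ h) :
    rho h (l / m) = rho h l := by
  obtain ⟨e, rfl⟩ := hml
  have h2 := Nat.squarefree_mul_iff.1 hl
  have hm0 : m ≠ 0 := h2.2.1.ne_zero
  have he0 : e ≠ 0 := h2.2.2.ne_zero
  rw [Nat.mul_div_cancel_left _ (Nat.pos_of_ne_zero hm0), rho_mul h m e hm0 he0 h2.1]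
  have h3 := rho_gcd h m h2.2.1
  rw [Nat.gcd_eq_left hmh] at h3
  have h4 : 0 < #m.divisors := card_pos.2 ⟨1, by simp [hm0]⟩
  have : rho h m = 1 := by
    apply Nat.eq_of_mul_eq_mul_right h4; rw [h3, one_mul]
  rw [this, one_mul]

/-- `σ_{-1}` -/
noncomputable def sig (h : ℕ) : ℝ := ∑ m ∈ h.divisors, 1 / (m : ℝ)

lemma one_le_sig (h : ℕ) (hh : h ≠ 0) : 1 ≤ sig h := by
  unfold sig
  have := single_le_sum (f := fun m : ℕ => 1 / (m : ℝ)) (s := h.divisors) (a := 1)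
    (fun i _ => by positivity) (by simp [hh])
  simpa using this

lemma lemA (h z : ℕ) (hh : h ≠ 0) :
    ∑ l ∈ D z, (#l.divisors : ℝ) / l ≤ sig h * ∑ l ∈ D z, nu h l := by
  have e1 : ∀ l ∈ D z, (#l.divisors : ℝ) / l =
      ∑ m ∈ (Nat.gcd l h).divisors, 1 / (m : ℝ) * nu h (l / m) := by
    intro l hl
    have hl' := (mem_D.1 hl).2.2
    have hl0 := hl'.ne_zero
    rw [← rho_gcd h l hl']
    have : ∀ m ∈ (Nat.gcd l h).divisors, 1 / (m : ℝ) * nu h (l / m) = rho h l / (l : ℝ) := by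
      intro m hm
      have hm1 := (Nat.dvd_of_mem_divisors hm).trans (Nat.gcd_dvd_left _ _)
      have hm2 := (Nat.dvd_of_mem_divisors hm).trans (Nat.gcd_dvd_right _ _)
      have hm0 : (m : ℝ) ≠ 0 := by exact_mod_cast (Nat.pos_of_mem_divisors hm).ne'
      rw [nu_apply, rho_div h l m hl' hm1 hm2, Nat.cast_div hm1 hm0]
      field_simp
    rw [sum_congr rfl this, sum_const, nsmul_eq_mul]
    push_cast; ring
  rw [sum_congr rfl e1, sum_sigma', sig, sum_mul_sum, ← sum_product']
  apply sum_le_sum_inj _ _ (fun x => (x.2, x.1 / x.2))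
  · rintro ⟨l, m⟩ hx
    simp only [mem_sigma, mem_product] at hx ⊢
    obtain ⟨hl, hm⟩ := hx
    have hm1 := (Nat.dvd_of_mem_divisors hm).trans (Nat.gcd_dvd_left _ _)
    have hm2 := (Nat.dvd_of_mem_divisors hm).trans (Nat.gcd_dvd_right _ _)
    refine ⟨by simp [hm2, hh], ?_⟩
    rw [mem_D] at hl ⊢
    have hd : l / m ∣ l := Nat.div_dvd_of_dvd hm1
    refine ⟨⟨Nat.div_pos (Nat.le_of_dvd hl.1.1 hm1) (Nat.pos_of_mem_divisors hm),
      (Nat.div_le_self _ _).trans hl.1.2⟩, hl.2.1.of_dvd_nat hd, hl.2.2.squarefree_of_dvd hd⟩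
  · rintro ⟨l, m⟩ hx ⟨l', m'⟩ hx' heq
    simp only [coe_sigma, Set.mem_sigma_iff, mem_coe, Prod.mk.injEq] at hx hx' heq
    obtain ⟨h1, h2⟩ := heq
    subst h1
    have hm1 := (Nat.dvd_of_mem_divisors hx.2).trans (Nat.gcd_dvd_left _ _)
    have hm1' := (Nat.dvd_of_mem_divisors hx'.2).trans (Nat.gcd_dvd_left _ _)
    have : l = l' := by
      rw [← Nat.div_mul_cancel hm1, ← Nat.div_mul_cancel hm1', h2]
    subst this; rfl
  · rintro ⟨l, m⟩ _; exact le_rfl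
  · rintro ⟨l, m⟩ _; simp only [nu_apply]; positivity

lemma sum_inv_sq (x : ℕ) : ∑ e ∈ Icc 1 x, 1 / (e : ℝ) ^ 2 ≤ 2 := by
  have := sum_Ioo_inv_sq_le (α := ℝ) 0 (x + 1)
  have h2 : Ioo 0 (x + 1) = Icc 1 x := by ext; simp; omega
  rw [h2] at this
  simpa using this

lemma lemB (x : ℕ) : (∑ a ∈ D x, 1 / (a : ℝ)) ^ 2 ≤ 2 * ∑ l ∈ D (x ^ 2), (#l.divisors : ℝ) / l := by
  have e1 : ∀ l ∈ D (x ^ 2), (#l.divisors : ℝ) / l = ∑ m ∈ l.divisors, 1 / (l : ℝ) := by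
    intro l _
    rw [sum_const, nsmul_eq_mul]; ring
  have h0 : 0 ≤ ∑ l ∈ D (x ^ 2), (#l.divisors : ℝ) / l := sum_nonneg fun _ _ => by positivity
  refine le_trans ?_ (mul_le_mul_of_nonneg_right (sum_inv_sq x) h0)
  rw [sum_congr rfl e1, sum_sigma', sq, sum_mul_sum, ← sum_product', sum_mul_sum, ← sum_product']
  apply sum_le_sum_inj _ _
    (fun q => (Nat.gcd q.1 q.2, ⟨(q.1 / Nat.gcd q.1 q.2) * (q.2 / Nat.gcd q.1 q.2),
      q.1 / Nat.gcd q.1 q.2⟩))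
  · rintro ⟨a, b⟩ hx
    simp only [mem_product, mem_D] at hx
    obtain ⟨⟨⟨a1, a2⟩, a3, a4⟩, ⟨b1, b2⟩, b3, b4⟩ := hx
    simp only [mem_product, mem_sigma, mem_D, mem_Icc, Nat.mem_divisors]
    have hg : 0 < Nat.gcd a b := Nat.gcd_pos_of_pos_left _ a1
    have ga := Nat.gcd_dvd_left a b
    have gb := Nat.gcd_dvd_right a b
    have hca := Nat.coprime_div_gcd_div_gcd hg
    have da : a / Nat.gcd a b ∣ a := Nat.div_dvd_of_dvd ga
    have db : b / Nat.gcd a b ∣ b := Nat.div_dvd_of_dvd gb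
    have pa : 0 < a / Nat.gcd a b := Nat.pos_of_dvd_of_pos da a1
    have pb : 0 < b / Nat.gcd a b := Nat.pos_of_dvd_of_pos db b1
    refine ⟨⟨hg, (Nat.le_of_dvd a1 ga).trans a2⟩, ⟨⟨Nat.mul_pos pa pb, ?_⟩, ?_, ?_⟩, dvd_mul_right _ _,
      (Nat.mul_pos pa pb).ne'⟩
    · rw [sq]
      exact Nat.mul_le_mul ((Nat.le_of_dvd a1 da).trans a2) ((Nat.le_of_dvd b1 db).trans b2)
    · exact (a3.of_dvd_nat da).mul (b3.of_dvd_nat db)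
    · rw [Nat.squarefree_mul_iff]
      exact ⟨hca, a4.squarefree_of_dvd da, b4.squarefree_of_dvd db⟩
  · rintro ⟨a, b⟩ hx ⟨a', b'⟩ hx' heq
    simp only [coe_product, Set.mem_prod, mem_coe, mem_D] at hx hx'
    simp only [Prod.mk.injEq, Sigma.mk.injEq, heq_eq_eq] at heq
    obtain ⟨h1, h2, h3⟩ := heq
    have hg : 0 < Nat.gcd a b := Nat.gcd_pos_of_pos_left _ hx.1.1.1
    have ea : a = a' := by
      rw [← Nat.div_mul_cancel (Nat.gcd_dvd_left a b), h3, h1,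
        Nat.div_mul_cancel (Nat.gcd_dvd_left a' b')]
    have pa : 0 < a / Nat.gcd a b :=
      Nat.pos_of_dvd_of_pos (Nat.div_dvd_of_dvd (Nat.gcd_dvd_left a b)) hx.1.1.1
    have h4 : b / Nat.gcd a b = b' / Nat.gcd a' b' := by
      rw [← h3] at h2
      exact Nat.eq_of_mul_eq_mul_left pa h2
    have eb : b = b' := by
      rw [← Nat.div_mul_cancel (Nat.gcd_dvd_right a b), h4, h1,
        Nat.div_mul_cancel (Nat.gcd_dvd_right a' b')]
    rw [ea, eb]
  · rintro ⟨a, b⟩ hx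
    simp only [mem_product, mem_D] at hx
    have hg : 0 < Nat.gcd a b := Nat.gcd_pos_of_pos_left _ hx.1.1.1
    have hg' : ((Nat.gcd a b : ℕ) : ℝ) ≠ 0 := by exact_mod_cast hg.ne'
    simp only
    rw [Nat.cast_mul, Nat.cast_div (Nat.gcd_dvd_left a b) hg',
      Nat.cast_div (Nat.gcd_dvd_right a b) hg']
    apply le_of_eq
    have : (a : ℝ) ≠ 0 := by exact_mod_cast (by omega : a ≠ 0)
    have : (b : ℝ) ≠ 0 := by exact_mod_cast (by omega : b ≠ 0)
    field_simp
  · rintro ⟨a, b⟩ _; positivity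

lemma lemC (x : ℕ) : ∑ m ∈ Icc 1 x with Odd m, 1 / (m : ℝ) ≤ 2 * ∑ a ∈ D x, 1 / (a : ℝ) := by
  have h0 : 0 ≤ ∑ a ∈ D x, 1 / (a : ℝ) := sum_nonneg fun _ _ => by positivity
  refine le_trans ?_ (mul_le_mul_of_nonneg_right (sum_inv_sq x) h0)
  rw [sum_mul_sum, ← sum_product']
  choose a b hab hsq using Nat.sq_mul_squarefree
  apply sum_le_sum_inj _ _ (fun m => (b m, a m))
  · intro m hm
    simp only [mem_filter, mem_Icc, mem_product, mem_D] at hm ⊢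
    have ha : a m ∣ m := ⟨b m ^ 2, by rw [mul_comm]; exact (hab m).symm⟩
    have hb : b m ∣ m := ⟨b m * a m, by rw [← mul_assoc, ← sq]; exact (hab m).symm⟩
    exact ⟨⟨Nat.pos_of_dvd_of_pos hb hm.1.1, (Nat.le_of_dvd hm.1.1 hb).trans hm.1.2⟩,
      ⟨Nat.pos_of_dvd_of_pos ha hm.1.1, (Nat.le_of_dvd hm.1.1 ha).trans hm.1.2⟩,
      hm.2.of_dvd_nat ha, hsq m⟩
  · intro m _ m' _ heq
    simp only [Prod.mk.injEq] at heq
    rw [← hab m, ← hab m', heq.1, heq.2]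
  · intro m _
    simp only
    rw [← mul_div_mul_comm, one_mul]
    conv_lhs => rw [← hab m]
    push_cast; exact le_rfl
  · rintro ⟨a, b⟩ _; positivity

lemma lemD (x : ℕ) : Real.log x ≤ 2 * ∑ m ∈ Icc 1 x with Odd m, 1 / (m : ℝ) := by
  have h1 : Real.log x ≤ ∑ m ∈ Icc 1 x, 1 / (m : ℝ) := by
    have := log_le_harmonic_floor (x : ℝ) (by positivity)
    rw [Nat.floor_natCast, harmonic_eq_sum_Icc] at this
    push_cast at this
    simpa using this
  have h2 := sum_filter_add_sum_filter_not (Icc 1 x) (fun m => Odd m) (fun m => 1 / (m : ℝ))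
  have h3 : ∑ m ∈ Icc 1 x with ¬ Odd m, 1 / (m : ℝ) ≤ ∑ m ∈ Icc 1 x with Odd m, 1 / (m : ℝ) := by
    apply sum_le_sum_inj _ _ (fun m => m - 1)
    · intro m hm
      simp only [mem_filter, mem_Icc, Nat.not_odd_iff_even] at hm ⊢
      obtain ⟨k, hk⟩ := hm.2
      refine ⟨by omega, ⟨k - 1, by omega⟩⟩
    · intro m hm m' hm' heq
      simp only [coe_filter, mem_Icc, Set.mem_ofPred_eq] at hm hm' heq
      omega
    · intro m hm
      simp only [mem_filter, mem_Icc, Nat.not_odd_iff_even] at hm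
      obtain ⟨k, hk⟩ := hm.2
      apply one_div_le_one_div_of_le
      · exact_mod_cast (by omega : 0 < m - 1)
      · exact_mod_cast (by omega : m - 1 ≤ m)
    · intros; positivity
  linarith

lemma lemE (h x : ℕ) (hh : h ≠ 0) :
    (Real.log x) ^ 2 / 32 ≤ sig h * ∑ l ∈ D (x ^ 2), nu h l := by
  have h1 := lemA h (x ^ 2) hh
  have h2 := lemB x
  have h3 := lemC x
  have h4 := lemD x
  have h5 : 0 ≤ Real.log x := Real.log_natCast_nonneg x
  have h6 : Real.log x / 4 ≤ ∑ a ∈ D x, 1 / (a : ℝ) := by linarith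
  have h7 : (Real.log x / 4) ^ 2 ≤ (∑ a ∈ D x, 1 / (a : ℝ)) ^ 2 := by gcongr
  nlinarith

end Rom
namespace Rom
open Finset BoundingSieve

/-- sifting primes -/
def pset (z : ℕ) : Finset ℕ := {p ∈ Icc 3 z | p.Prime}

lemma mem_pset {z p : ℕ} : p ∈ pset z ↔ (3 ≤ p ∧ p ≤ z) ∧ p.Prime := by simp [pset]

/-- product of odd primes up to `z` -/
def PP (z : ℕ) : ℕ := ∏ p ∈ pset z, p

lemma PP_sqfree (z : ℕ) : Squarefree (PP z) := by
  unfold PP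
  apply Finset.squarefree_prod_of_pairwise_isCoprime
  · intro p hp q hq hpq
    have hp' := (mem_pset.1 hp).2
    have hq' := (mem_pset.1 hq).2
    exact Nat.coprime_iff_isRelPrime.1 ((Nat.coprime_primes hp' hq').2 hpq)
  · intro p hp
    exact (mem_pset.1 hp).2.prime.irreducible.squarefree

lemma prime_dvd_PP {z p : ℕ} (hp : p.Prime) (h : p ∣ PP z) : 3 ≤ p ∧ p ≤ z := by
  unfold PP at h
  obtain ⟨q, hq, hpq⟩ := (Prime.dvd_finset_prod_iff hp.prime _).1 h
  have hq' := mem_pset.1 hq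
  rw [(Nat.prime_dvd_prime_iff_eq hp hq'.2).1 hpq]
  exact hq'.1

lemma D_dvd_PP {z l : ℕ} (hl : l ∈ D z) : l ∣ PP z := by
  rw [mem_D] at hl
  rw [← Nat.prod_primeFactors_of_squarefree hl.2.2]
  apply prod_dvd_prod_of_subset
  intro p hp
  rw [Nat.mem_primeFactors] at hp
  rw [mem_pset]
  have hodd := hl.2.1.of_dvd_nat hp.2.1
  refine ⟨⟨?_, (Nat.le_of_dvd hl.1.1 hp.2.1).trans hl.1.2⟩, hp.1⟩
  have := hp.1.two_le
  rcases hodd with ⟨k, hk⟩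
  omega

lemma rho_prime_le (h p : ℕ) (hp : p.Prime) : rho h p ≤ 2 := by
  by_cases hph : p ∣ h
  · rw [rho_prime_dvd h p hp hph]; omega
  · rw [rho_prime_not_dvd h p hp hph]

/-- the sieve -/
noncomputable def sv (h N z : ℕ) : BoundingSieve where
  support := (range N).image (fun n => n * (n + h))
  prodPrimes := PP z
  prodPrimes_squarefree := PP_sqfree z
  weights := fun _ => 1
  weights_nonneg := fun _ => zero_le_one
  totalMass := N
  nu := nu h
  nu_mult := nu_mult h
  nu_pos_of_prime := by
    intro p hp _
    rw [nu_apply]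
    have h1 : (0 : ℝ) < rho h p := by exact_mod_cast rho_pos h p hp.pos
    have h2 : (0 : ℝ) < p := by exact_mod_cast hp.pos
    positivity
  nu_lt_one_of_prime := by
    intro p hp hpz
    rw [nu_apply]
    have h1 : (rho h p : ℝ) ≤ 2 := by exact_mod_cast rho_prime_le h p hp
    have h2 : (3 : ℝ) ≤ p := by exact_mod_cast (prime_dvd_PP hp hpz).1
    rw [div_lt_one (by linarith)]
    linarith

lemma inj_h (h : ℕ) : Function.Injective (fun n : ℕ => n * (n + h)) ∨ h = 0 := by
  by_cases hh : h = 0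
  · exact Or.inr hh
  · left
    apply StrictMono.injective
    intro a b hab
    simp only
    nlinarith [Nat.pos_of_ne_zero hh]

lemma sv_multSum (h N z d : ℕ) (hh : h ≠ 0) :
    (sv h N z).multSum d = (#{n ∈ range N | d ∣ n * (n + h)} : ℝ) := by
  have hi := (inj_h h).resolve_right hh
  simp only [multSum, sv]
  rw [sum_image (fun a _ b _ hab => hi hab)]
  simp

lemma G_ge (h N x : ℕ) :
    ∑ l ∈ D (x ^ 2), nu h l ≤ G (sv h N (x ^ 2)) (x ^ 2) := by
  unfold G
  calc ∑ l ∈ D (x ^ 2), nu h l ≤ ∑ l ∈ D (x ^ 2), (sv h N (x ^ 2)).selbergTerms l := by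
        apply sum_le_sum
        intro l hl
        have hd : l ∣ (sv h N (x ^ 2)).prodPrimes := D_dvd_PP hl
        rw [selbergTerms_apply]
        change nu h l ≤ nu h l * _
        apply le_mul_of_one_le_right (nu_pos_of_dvd_prodPrimes hd).le
        refine le_trans (le_of_eq (prod_const_one (s := l.primeFactors)).symm)
          (prod_le_prod (fun _ _ => zero_le_one) ?_)
        intro p hp
        have hp' := Nat.mem_primeFactors.1 hp
        have h1 := (sv h N (x ^ 2)).nu_lt_one_of_prime p hp'.1 (hp'.2.1.trans hd)
        have h2 := (sv h N (x ^ 2)).nu_pos_of_prime p hp'.1 (hp'.2.1.trans hd)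
        rw [one_le_inv₀ (by linarith)]
        linarith
    _ ≤ _ := by
        apply sum_le_sum_of_subset_of_nonneg
        · intro l hl
          rw [mem_filter, Nat.mem_divisors]
          exact ⟨⟨D_dvd_PP hl, prodPrimes_ne_zero⟩, (mem_D.1 hl).1.2⟩
        · intro l hl _
          rw [mem_filter, Nat.mem_divisors] at hl
          exact (selbergTerms_pos hl.1.1).le

/-- number of prime pairs -/
def pairs (h N : ℕ) : ℕ := #{p ∈ range N | p.Prime ∧ (p + h).Prime}

lemma sifted_ge (h N z : ℕ) (hh : h ≠ 0) :
    (pairs h N : ℝ) ≤ (z + 1) + (sv h N z).siftedSum := by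
  have hi := (inj_h h).resolve_right hh
  have h1 : (sv h N z).siftedSum = (#{n ∈ range N | Nat.Coprime (PP z) (n * (n + h))} : ℝ) := by
    change ∑ d ∈ (range N).image (fun n => n * (n + h)),
      (if Nat.Coprime (PP z) d then (1 : ℝ) else 0) = _
    rw [sum_image (fun a _ b _ hab => hi hab)]
    simp
  rw [h1]
  have h2 : pairs h N ≤ #(range (z + 1) ∪ {n ∈ range N | Nat.Coprime (PP z) (n * (n + h))}) := by
    unfold pairs
    apply card_le_card
    intro p hp
    simp only [mem_filter, mem_range, mem_union] at hp ⊢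
    by_cases hpz : p < z + 1
    · exact Or.inl hpz
    · right
      refine ⟨hp.1, ?_⟩
      have key : ∀ q : ℕ, q.Prime → z < q → (PP z).Coprime q := by
        intro q hq hzq
        rw [Nat.coprime_comm, hq.coprime_iff_not_dvd]
        intro hd
        have := prime_dvd_PP hq hd
        omega
      exact Nat.Coprime.mul_right (key p hp.2.1 (by omega)) (key (p + h) hp.2.2 (by omega))
  have h3 := h2.trans (card_union_le _ _)
  rw [card_range] at h3
  exact_mod_cast h3

lemma pairs_le (h N x : ℕ) (hh : h ≠ 0) (hx : 2 ≤ x) :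
    (pairs h N : ℝ) ≤ N * (32 * sig h / (Real.log x) ^ 2) + ((x : ℝ) ^ 2 + 1 + (x : ℝ) ^ 12) := by
  have hz : 1 ≤ x ^ 2 := Nat.one_le_pow _ _ (by omega)
  have h1 := sifted_ge h N (x ^ 2) hh
  have h2 := selberg (s := sv h N (x ^ 2)) (z := x ^ 2) hz (by simp [sv])
    (by
      intro d hd
      have hd0 : 0 < d := Nat.pos_of_dvd_of_pos hd (Nat.pos_of_ne_zero prodPrimes_ne_zero)
      change (nu h d)⁻¹ ≤ _
      rw [nu_apply, inv_div]
      apply div_le_self (by positivity)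
      exact_mod_cast rho_pos h d hd0)
    (by
      intro d hd
      have hd0 : 0 < d := Nat.pos_of_dvd_of_pos hd (Nat.pos_of_ne_zero prodPrimes_ne_zero)
      rw [rem, sv_multSum h N _ d hh]
      change |_ - nu h d * (N : ℝ)| ≤ _
      rw [nu_apply]
      exact count_bound h d N hd0)
  have h3 : (Real.log x) ^ 2 / 32 ≤ sig h * G (sv h N (x ^ 2)) (x ^ 2) := by
    refine (lemE h x hh).trans ?_
    have := one_le_sig h hh
    exact mul_le_mul_of_nonneg_left (G_ge h N x) (by linarith)
  have hG := G_pos (s := sv h N (x ^ 2)) hz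
  have hlog : 0 < Real.log x := Real.log_pos (by exact_mod_cast (by omega : 1 < x))
  have h4 : (G (sv h N (x ^ 2)) (x ^ 2))⁻¹ ≤ 32 * sig h / (Real.log x) ^ 2 := by
    rw [inv_eq_one_div, div_le_div_iff₀ hG (by positivity)]
    linarith
  have h5 : (N : ℝ) * (G (sv h N (x ^ 2)) (x ^ 2))⁻¹ ≤ N * (32 * sig h / (Real.log x) ^ 2) := by
    gcongr
  have h6 : (sv h N (x ^ 2)).totalMass = N := rfl
  rw [h6] at h2
  push_cast at h1 h2
  have h7 : ((x : ℝ) ^ 2) ^ 6 = (x : ℝ) ^ 12 := by ring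
  rw [h7] at h2
  linarith

theorem sieve_bound : ∃ C : ℝ, 0 < C ∧ ∀ N : ℕ, 2 ^ 48 ≤ N → ∀ h : ℕ, h ≠ 0 →
    (pairs h N : ℝ) ≤ C * (N / (Real.log N) ^ 2) * sig h := by
  refine ⟨48 + 32 * 48 ^ 2, by norm_num, ?_⟩
  intro N hN h hh
  have hN' : (2 : ℝ) ^ 48 ≤ N := by exact_mod_cast hN
  have hN0 : (0 : ℝ) < N := by linarith [show (0 : ℝ) < 2 ^ 48 by positivity]
  set t : ℝ := (N : ℝ) ^ ((1 : ℝ) / 48) with ht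
  have ht0 : 0 < t := Real.rpow_pos_of_pos hN0 _
  have htN : t ^ 48 = N := by
    rw [ht, ← Real.rpow_natCast, ← Real.rpow_mul hN0.le]; norm_num
  have ht2 : 2 ≤ t := by
    by_contra hc
    push Not at hc
    have : t ^ 48 < 2 ^ 48 := pow_lt_pow_left₀ hc ht0.le (by norm_num)
    linarith
  set x := ⌊t ^ 2⌋₊ with hx
  have hx1 : (x : ℝ) ≤ t ^ 2 := Nat.floor_le (by positivity)
  have hx2 : t ^ 2 < x + 1 := Nat.lt_floor_add_one _
  have hx3 : t ≤ x := by nlinarith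
  have hx4 : 2 ≤ x := by exact_mod_cast ht2.trans hx3
  have hlogN : Real.log N = 48 * Real.log t := by rw [← htN, Real.log_pow]; norm_num
  have hlogt : 0 < Real.log t := Real.log_pos (by linarith)
  have hlogx : Real.log t ≤ Real.log x := Real.log_le_log ht0 hx3
  have hlogt2 : Real.log t ≤ t := (Real.log_le_sub_one_of_pos ht0).trans (by linarith)
  have h1 := pairs_le h N x hh hx4
  have hsig := one_le_sig h hh
  have h2 : (N : ℝ) * (32 * sig h / (Real.log x) ^ 2) ≤ 32 * 48 ^ 2 * (N / (Real.log N) ^ 2) * sig h := by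
    calc (N : ℝ) * (32 * sig h / (Real.log x) ^ 2) ≤ (N : ℝ) * (32 * sig h / (Real.log t) ^ 2) := by
          gcongr
      _ = _ := by rw [hlogN]; field_simp
  have hx12 : (x : ℝ) ^ 12 ≤ t ^ 24 := by
    calc (x : ℝ) ^ 12 ≤ (t ^ 2) ^ 12 := by gcongr
      _ = _ := by ring
  have hx22 : (x : ℝ) ^ 2 ≤ t ^ 24 := by
    refine le_trans ?_ hx12
    exact pow_le_pow_right₀ (by exact_mod_cast (by omega : 1 ≤ x)) (by norm_num)
  have ht24 : 1 ≤ t ^ 24 := one_le_pow₀ (by linarith)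
  have h3 : (x : ℝ) ^ 2 + 1 + (x : ℝ) ^ 12 ≤ 48 * (N / (Real.log N) ^ 2) * sig h := by
    have h4 : 3 * t ^ 24 ≤ 48 * (N / (Real.log N) ^ 2) := by
      rw [hlogN, ← htN, mul_div_assoc', le_div_iff₀ (by positivity)]
      have h5 : t ^ 2 * 2 ^ 22 ≤ t ^ 24 := by
        rw [show t ^ 24 = t ^ 2 * t ^ 22 by ring]
        gcongr
      have h6 : (48 * Real.log t) ^ 2 ≤ (48 * t) ^ 2 := by gcongr
      have h7 : (48 * Real.log t) ^ 2 ≤ 16 * t ^ 24 := by nlinarith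
      calc 3 * t ^ 24 * (48 * Real.log t) ^ 2 ≤ 3 * t ^ 24 * (16 * t ^ 24) := by gcongr
        _ = _ := by ring
    have h8 : 0 ≤ 48 * (N / (Real.log N) ^ 2) := by positivity
    nlinarith
  linarith

end Rom
namespace Rom
open Finset
open scoped Pointwise

/-- `⌊y^k⌋` -/
noncomputable def b (y : ℝ) (k : ℕ) : ℕ := ⌊y ^ k⌋₊

lemma b_cast {y : ℝ} (hy : 1 < y) (k : ℕ) : ⌊y ^ k⌋ = (b y k : ℤ) := by
  unfold b
  rw [Int.natCast_floor_eq_floor]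
  positivity

lemma b_pos {y : ℝ} (hy : 1 < y) (k : ℕ) : 1 ≤ b y k := by
  unfold b
  rw [Nat.one_le_floor_iff]
  exact one_le_pow₀ hy.le

lemma b_le {y : ℝ} (hy : 1 < y) (k N : ℕ) (hN : 1 ≤ N) (hk : (k : ℝ) ≤ Real.log N / Real.log y) :
    b y k ≤ N := by
  unfold b
  have hl : 0 < Real.log y := Real.log_pos hy
  rw [le_div_iff₀ hl, ← Real.log_pow] at hk
  have hN' : (0 : ℝ) < N := by exact_mod_cast hN
  have h2 : y ^ k ≤ N := (Real.log_le_log_iff (by positivity) hN').1 hk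
  exact Nat.floor_le_of_le h2

lemma c_strict {y : ℝ} (hy : 1 < y) (j : ℕ) (hj : 2 ≤ y ^ j) : StrictMono (fun m => b y (j * m)) := by
  apply strictMono_nat_of_lt_succ
  intro m
  unfold b
  have h1 : (1 : ℝ) ≤ y ^ (j * m) := one_le_pow₀ hy.le
  have h2 : y ^ (j * m) + 1 ≤ y ^ (j * (m + 1)) := by
    rw [mul_add, mul_one, pow_add]
    nlinarith
  have h3 : ⌊y ^ (j * m)⌋₊ + 1 = ⌊y ^ (j * m) + 1⌋₊ := (Nat.floor_add_one (by positivity)).symm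
  rw [Nat.lt_iff_add_one_le, h3]
  exact Nat.floor_le_floor h2

/-- absolute difference -/
def df (a c : ℕ) : ℕ := (a - c) + (c - a)

lemma df_dvd {a c d : ℕ} (h : d ∣ df a c) : (a : ℤ) ≡ c [ZMOD d] := by
  unfold df at h
  rw [Int.modEq_iff_dvd]
  rcases le_total a c with h1 | h1
  · have : a - c + (c - a) = c - a := by omega
    rw [this] at h
    have := Int.natCast_dvd_natCast.2 h
    rwa [Nat.cast_sub h1] at this
  · have : a - c + (c - a) = a - c := by omega
    rw [this] at h
    have := Int.natCast_dvd_natCast.2 h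
    rw [Nat.cast_sub h1] at this
    have h2 := (dvd_neg).2 this
    rwa [neg_sub] at h2

lemma cnt_finite (N d a : ℕ) (y : ℝ) : {k : ℕ | 1 ≤ k ∧ (k : ℝ) ≤ Real.log N / Real.log y ∧
    ⌊y ^ k⌋ ≡ (a : ℤ) [ZMOD (d : ℤ)]}.Finite := by
  apply (Set.finite_Iic (⌊Real.log N / Real.log y⌋₊)).subset
  intro k hk
  exact Nat.le_floor hk.2.1

lemma sum_sig {y : ℝ} (hy : 1 < y) (j : ℕ) (hj : 2 ≤ y ^ j) (N M : ℕ) (hN : 1 ≤ N) (hj1 : 1 ≤ j)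
    (hM : ∀ m, m ≤ M → ((j * m : ℕ) : ℝ) ≤ Real.log N / Real.log y) (m₁ : ℕ) (hm₁ : m₁ ∈ Icc 1 M) :
    ∑ m ∈ Icc 1 M with m ≠ m₁, sig (df (b y (j * m)) (b y (j * m₁))) ≤ fN N y := by
  have hinj := (c_strict hy j hj).injective
  have hbN : ∀ m, m ≤ M → b y (j * m) ≤ N := fun m hm => b_le hy _ N hN (hM m hm)
  calc ∑ m ∈ Icc 1 M with m ≠ m₁, sig (df (b y (j * m)) (b y (j * m₁)))
      ≤ ∑ m ∈ Icc 1 M with m ≠ m₁, ∑ d ∈ Icc 1 N,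
        (if d ∣ df (b y (j * m)) (b y (j * m₁)) then 1 / (d : ℝ) else 0) := by
        apply sum_le_sum
        intro m hm
        rw [mem_filter, mem_Icc] at hm
        rw [mem_Icc] at hm₁
        rw [← sum_filter]
        unfold sig
        apply sum_le_sum_of_subset_of_nonneg
        · intro d hd
          rw [mem_filter, mem_Icc]
          have hd1 := Nat.dvd_of_mem_divisors hd
          have hd2 := Nat.pos_of_mem_divisors hd
          refine ⟨⟨hd2, ?_⟩, hd1⟩
          refine (Nat.divisor_le hd).trans ?_
          have := hbN m hm.1.2
          have := hbN m₁ hm₁.2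
          unfold df; omega
        · intros; positivity
    _ = ∑ d ∈ Icc 1 N, (1 / (d : ℝ)) *
          (#{m ∈ (Icc 1 M).filter (fun m => m ≠ m₁) | d ∣ df (b y (j * m)) (b y (j * m₁))} : ℝ) := by
        rw [sum_comm]
        apply sum_congr rfl
        intro d _
        rw [← sum_filter, sum_const, nsmul_eq_mul, mul_comm]
    _ ≤ fN N y := by
        unfold fN
        apply sum_le_sum
        intro d hd
        rw [mem_Icc] at hd
        gcongr
        have hb1 := b_pos hy (j * m₁)
        set a := (b y (j * m₁) - 1) % d + 1 with ha
        have ha1 : a ∈ Icc 1 d := by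
          rw [mem_Icc]
          have := Nat.mod_lt (b y (j * m₁) - 1) hd.1
          omega
        have ha2 : (b y (j * m₁) : ℤ) ≡ a [ZMOD d] := by
          rw [Int.natCast_modEq_iff]
          have h1 : (b y (j * m₁) - 1) % d + 1 ≡ (b y (j * m₁) - 1) + 1 [MOD d] :=
            Nat.ModEq.add_right _ (Nat.mod_modEq _ _)
          rw [Nat.sub_add_cancel hb1] at h1
          exact h1.symm
        refine le_trans ?_ (le_sup (f := fun a => cnt N d a y) ha1)
        unfold cnt
        rw [Nat.card_coe_set_eq, ← Set.ncard_coe_finset]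
        apply Set.ncard_le_ncard_of_injOn (fun m => j * m) _ _ (cnt_finite N d a y)
        · intro m hm
          simp only [coe_filter, mem_filter, mem_Icc, Set.mem_ofPred_eq] at hm
          refine ⟨Nat.mul_pos hj1 hm.1.1.1, hM m hm.1.1.2, ?_⟩
          rw [b_cast hy]
          exact (df_dvd hm.2).trans ha2
        · intro m _ m' _ hmm
          exact Nat.eq_of_mul_eq_mul_left hj1 hmm

/-- primes up to `N` -/
def Pr (N : ℕ) : Finset ℕ := {p ∈ range (N + 1) | p.Prime}

lemma card_Pr (N : ℕ) : #(Pr N) = Nat.primeCounting N := by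
  rw [Nat.primeCounting, Nat.primeCounting', Nat.count_eq_card_filter_range, Pr]

lemma pairs_df (N a c : ℕ) (hac : a ≠ c) :
    #{q ∈ Pr N ×ˢ Pr N | q.1 + a = q.2 + c} ≤ pairs (df a c) (N + 1) := by
  unfold pairs
  rcases lt_or_gt_of_ne hac with h | h
  · have hd : df a c = c - a := by unfold df; omega
    apply card_le_card_of_injOn (fun q => q.2)
    · intro q hq
      simp only [coe_filter, mem_product, Pr, mem_filter, mem_range, Set.mem_ofPred_eq] at hq ⊢
      refine ⟨hq.1.2.1, hq.1.2.2, ?_⟩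
      have : q.2 + df a c = q.1 := by omega
      rw [this]; exact hq.1.1.2
    · intro q hq q' hq' hqq
      simp only [coe_filter, Set.mem_ofPred_eq] at hq hq' hqq
      ext
      · omega
      · exact hqq
  · have hd : df a c = a - c := by unfold df; omega
    apply card_le_card_of_injOn (fun q => q.1)
    · intro q hq
      simp only [coe_filter, mem_product, Pr, mem_filter, mem_range, Set.mem_ofPred_eq] at hq ⊢
      refine ⟨hq.1.1.1, hq.1.1.2, ?_⟩
      have : q.1 + df a c = q.2 := by omega
      rw [this]; exact hq.1.2.2
    · intro q hq q' hq' hqq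
      simp only [coe_filter, Set.mem_ofPred_eq] at hq hq' hqq
      ext
      · exact hqq
      · omega

lemma pairs_same (N a : ℕ) : #{q ∈ Pr N ×ˢ Pr N | q.1 + a = q.2 + a} ≤ #(Pr N) := by
  apply card_le_card_of_injOn (fun q => q.1)
  · intro q hq
    simp only [coe_filter, mem_product, Set.mem_ofPred_eq] at hq
    exact hq.1.1
  · intro q hq q' hq' hqq
    simp only [coe_filter, Set.mem_ofPred_eq] at hq hq' hqq
    ext
    · exact hqq
    · omega

lemma energy_eq (A B : Finset ℕ) :
    A.addEnergy B = ∑ b₁ ∈ B, ∑ b₂ ∈ B, #{q ∈ A ×ˢ A | q.1 + b₁ = q.2 + b₂} := by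
  unfold addEnergy
  rw [card_filter, sum_product_right, sum_product]
  simp_rw [card_filter]

theorem energy_bound {y : ℝ} (hy : 1 < y) (j : ℕ) (hj : 2 ≤ y ^ j) (N M : ℕ) (hN : 1 ≤ N)
    (hj1 : 1 ≤ j)
    (hM : ∀ m, m ≤ M → ((j * m : ℕ) : ℝ) ≤ Real.log N / Real.log y) (R : ℝ)
    (hR0 : 0 ≤ R) (hR : ∀ h : ℕ, h ≠ 0 → (pairs h (N + 1) : ℝ) ≤ R * sig h) :
    (((Pr N).addEnergy ((Icc 1 M).image (fun m => b y (j * m))) : ℕ) : ℝ) ≤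
      M * (Nat.primeCounting N + R * fN N y) := by
  have hinj := (c_strict hy j hj).injective
  rw [energy_eq, sum_image (fun _ _ _ _ h => hinj h)]
  push_cast
  have key : ∀ m₁ ∈ Icc 1 M, ((∑ b₂ ∈ (Icc 1 M).image (fun m => b y (j * m)),
      (#{q ∈ Pr N ×ˢ Pr N | q.1 + b y (j * m₁) = q.2 + b₂} : ℝ))) ≤
      Nat.primeCounting N + R * fN N y := by
    intro m₁ hm₁
    rw [sum_image (fun _ _ _ _ h => hinj h)]
    rw [← sum_filter_add_sum_filter_not (Icc 1 M) (fun m => m = m₁)]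
    apply add_le_add
    · rw [filter_eq' , if_pos hm₁, sum_singleton, ← card_Pr]
      exact_mod_cast pairs_same N _
    · refine le_trans ?_ (mul_le_mul_of_nonneg_left (sum_sig hy j hj N M hN hj1 hM m₁ hm₁) hR0)
      rw [mul_sum]
      apply sum_le_sum
      intro m hm
      rw [mem_filter] at hm
      have hne : b y (j * m₁) ≠ b y (j * m) := fun h => hm.2 (hinj h).symm
      have h1 : df (b y (j * m₁)) (b y (j * m)) = df (b y (j * m)) (b y (j * m₁)) := by
        unfold df; omega
      have h2 : df (b y (j * m)) (b y (j * m₁)) ≠ 0 := by unfold df; omega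
      refine le_trans ?_ (hR _ h2)
      rw [← h1]
      exact_mod_cast pairs_df N _ _ hne
  refine (sum_le_sum key).trans ?_
  rw [sum_const, nsmul_eq_mul, Nat.card_Icc, Nat.add_sub_cancel]

/-- counting function -/
noncomputable def A (y : ℝ) (N : ℕ) : ℕ := Nat.card {n : ℕ | n ∈ Sy y ∧ n ∈ Set.Icc 1 N}

lemma A_finite (y : ℝ) (N : ℕ) : {n : ℕ | n ∈ Sy y ∧ n ∈ Set.Icc 1 N}.Finite :=
  (Set.finite_Icc 1 N).subset fun _ h => h.2

lemma A_mono (y : ℝ) {N N' : ℕ} (h : N ≤ N') : A y N ≤ A y N' := by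
  unfold A
  rw [Nat.card_coe_set_eq, Nat.card_coe_set_eq]
  apply Set.ncard_le_ncard _ (A_finite y N')
  intro n hn
  exact ⟨hn.1, hn.2.1, hn.2.2.trans h⟩

lemma A_le (y : ℝ) (N : ℕ) : A y N ≤ N := by
  unfold A
  rw [Nat.card_coe_set_eq]
  have := Set.ncard_le_ncard (s := {n : ℕ | n ∈ Sy y ∧ n ∈ Set.Icc 1 N}) (fun _ h => h.2)
    (Set.finite_Icc 1 N)
  refine this.trans ?_
  rw [← coe_Icc, Set.ncard_coe_finset]; simp

lemma sumset_le {y : ℝ} (hy : 1 < y) (j : ℕ) (N M : ℕ) (hN : 1 ≤ N) (hj1 : 1 ≤ j)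
    (hM : ∀ m, m ≤ M → ((j * m : ℕ) : ℝ) ≤ Real.log N / Real.log y) :
    #(Pr N + (Icc 1 M).image (fun m => b y (j * m))) ≤ A y (2 * N) := by
  unfold A
  rw [Nat.card_coe_set_eq, ← Set.ncard_coe_finset]
  apply Set.ncard_le_ncard _ (A_finite y (2 * N))
  intro n hn
  rw [Finset.mem_coe, Finset.mem_add] at hn
  obtain ⟨p, hp, c, hc, rfl⟩ := hn
  rw [mem_image] at hc
  obtain ⟨m, hm, rfl⟩ := hc
  rw [mem_Icc] at hm
  simp only [Pr, mem_filter, mem_range] at hp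
  have h1 := b_le hy _ N hN (hM m hm.2)
  have h2 := b_pos hy (j * m)
  refine ⟨⟨p, j * m, hp.2, Nat.mul_pos hj1 hm.1, ?_⟩, ?_, ?_⟩
  · rw [b_cast hy]; push_cast; rfl
  · omega
  · omega

theorem main_ineq {y : ℝ} (hy : 1 < y) (j : ℕ) (hj : 2 ≤ y ^ j) (N M : ℕ) (hN : 1 ≤ N)
    (hj1 : 1 ≤ j)
    (hM : ∀ m, m ≤ M → ((j * m : ℕ) : ℝ) ≤ Real.log N / Real.log y) (R : ℝ)
    (hR0 : 0 ≤ R) (hR : ∀ h : ℕ, h ≠ 0 → (pairs h (N + 1) : ℝ) ≤ R * sig h) :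
    ((Nat.primeCounting N : ℝ) * M) ^ 2 ≤
      A y (2 * N) * (M * (Nat.primeCounting N + R * fN N y)) := by
  have hinj := (c_strict hy j hj).injective
  have h1 := le_card_add_mul_addEnergy (Pr N) ((Icc 1 M).image (fun m => b y (j * m)))
  rw [card_Pr, card_image_of_injective _ hinj, Nat.card_Icc, Nat.add_sub_cancel] at h1
  have h1' : ((Nat.primeCounting N : ℝ)) ^ 2 * (M : ℝ) ^ 2 ≤
      (#(Pr N + (Icc 1 M).image (fun m => b y (j * m))) : ℝ) *
      (((Pr N).addEnergy ((Icc 1 M).image (fun m => b y (j * m))) : ℕ) : ℝ) := by exact_mod_cast h1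
  rw [mul_pow]
  refine h1'.trans ?_
  have h2 := energy_bound hy j hj N M hN hj1 hM R hR0 hR
  have h3 : (#(Pr N + (Icc 1 M).image (fun m => b y (j * m))) : ℝ) ≤ A y (2 * N) := by
    exact_mod_cast sumset_le hy j N M hN hj1 hM
  gcongr

end Rom
namespace Rom
open Finset

lemma fN_bound {y : ℝ} (hf : f y < ⊤) : ∃ C : ℝ, 0 ≤ C ∧ ∀ᶠ N : ℕ in atTop, fN N y ≤ C * Real.log N := by
  obtain ⟨c, hc1, hc2⟩ := ENNReal.lt_iff_exists_nnreal_btwn.1 hf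
  refine ⟨c, c.2, ?_⟩
  have h1 := eventually_lt_of_limsup_lt hc1
  filter_upwards [h1, eventually_ge_atTop 2] with N hN hN2
  have hl : 0 < Real.log N := Real.log_pos (by exact_mod_cast hN2)
  have h3 := (ENNReal.ofReal_le_iff_le_toReal ENNReal.coe_ne_top).1 hN.le
  rw [ENNReal.coe_toReal, div_le_iff₀ hl] at h3
  exact h3

lemma pi_lower (N : ℕ) (hN : 2 ^ 48 ≤ N) : (N : ℝ) / Real.log N / 4 ≤ Nat.primeCounting N := by
  refine le_trans ?_ (Chebyshev.pi_ge N)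
  have hN' : (2 : ℝ) ^ 48 ≤ N := by exact_mod_cast hN
  have hl : 0 < Real.log N := Real.log_pos (by linarith [show (1 : ℝ) < 2 ^ 48 by norm_num])
  rw [div_div, div_le_div_iff₀ (by positivity) hl]
  have h2 : Real.log ((N : ℝ) + 1) ≤ (N + 1) / 8 + 2 := by
    have e : ((N : ℝ) + 1) = ((N + 1) / 8) * 2 ^ 3 := by ring
    have h3 := Real.log_le_sub_one_of_pos (show (0 : ℝ) < (N + 1) / 8 by positivity)
    rw [e, Real.log_mul (by positivity) (by norm_num), Real.log_pow]
    have := Real.log_two_lt_d9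
    push_cast
    linarith
  have h4 := Real.log_two_gt_d9
  have h5 : (N : ℝ) / 4 ≤ N * Real.log 2 - Real.log ((N : ℝ) + 1) := by
    have hN'' : (1000 : ℝ) ≤ N := by linarith [show (1000 : ℝ) ≤ 2 ^ 48 by norm_num]
    have h6 := mul_le_mul_of_nonneg_left h4.le (show (0 : ℝ) ≤ N by linarith)
    linarith
  calc (N : ℝ) * Real.log N = N / 4 * (Real.log N * 4) := by ring
    _ ≤ _ := by gcongr

theorem dens {y : ℝ} (hy : 1 < y) (hf : f y < ⊤) :
    ∃ c : ℝ, 0 < c ∧ ∀ᶠ N : ℕ in atTop, c * N ≤ A y (2 * N) := by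
  obtain ⟨C₀, hC₀, hfN⟩ := fN_bound hf
  obtain ⟨C, hC, hsieve⟩ := sieve_bound
  obtain ⟨j, hj⟩ := pow_unbounded_of_one_lt 2 hy
  have hj1 : 1 ≤ j := by
    by_contra h
    have : j = 0 := by omega
    subst this; norm_num at hj
  have hly : 0 < Real.log y := Real.log_pos hy
  have hpi : ∀ᶠ N : ℕ in atTop, (Nat.primeCounting N : ℝ) ≤ (Real.log 4 + 1) * N / Real.log N := by
    have := tendsto_natCast_atTop_atTop.eventually
      (Chebyshev.eventually_primeCounting_le (ε := 1) one_pos)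
    simpa using this
  have hlog : Tendsto (fun N : ℕ => Real.log N) atTop atTop :=
    Real.tendsto_log_atTop.comp tendsto_natCast_atTop_atTop
  have hl4 : 0 < Real.log 4 := Real.log_pos (by norm_num)
  set E : ℝ := (Real.log 4 + 1 + 2 * C * C₀) / Real.log y with hE
  have hE0 : 0 < E := by positivity
  set c₁ : ℝ := 1 / (8 * (j * Real.log y)) with hc₁
  have hj0 : (0 : ℝ) < j := by exact_mod_cast hj1
  have hc₁0 : 0 < c₁ := by positivity
  refine ⟨c₁ ^ 2 / E, by positivity, ?_⟩
  filter_upwards [hfN, hpi, eventually_ge_atTop (2 ^ 48),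
    hlog.eventually_ge_atTop (2 * (j * Real.log y))] with N h1 h2 hN h3
  have hN1 : 1 ≤ N := le_trans (Nat.one_le_two_pow) hN
  have hN0 : (0 : ℝ) < N := by exact_mod_cast hN1
  set L := Real.log N with hL
  have hL0 : 0 < L := lt_of_lt_of_le (by positivity) h3
  set M := ⌊L / Real.log y⌋₊ / j with hM
  have hMj : j * M ≤ ⌊L / Real.log y⌋₊ := Nat.mul_div_le _ _
  have hfl : ((⌊L / Real.log y⌋₊ : ℕ) : ℝ) ≤ L / Real.log y := Nat.floor_le (by positivity)
  have hMk : ∀ m, m ≤ M → ((j * m : ℕ) : ℝ) ≤ L / Real.log y := by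
    intro m hm
    refine le_trans ?_ hfl
    exact_mod_cast (Nat.mul_le_mul_left j hm).trans hMj
  have hMup : (M : ℝ) ≤ L / Real.log y := by
    refine le_trans ?_ hfl
    exact_mod_cast Nat.div_le_self _ _
  have hMlow : L / (2 * (j * Real.log y)) ≤ M := by
    have a1 : L / Real.log y < (⌊L / Real.log y⌋₊ : ℕ) + 1 := Nat.lt_floor_add_one _
    have a2 : ⌊L / Real.log y⌋₊ + 1 ≤ j * (M + 1) := by
      have := Nat.lt_mul_div_succ ⌊L / Real.log y⌋₊ (show 0 < j by omega)
      exact Nat.succ_le_of_lt this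
    have a3 : ((⌊L / Real.log y⌋₊ : ℕ) : ℝ) + 1 ≤ j * (M + 1) := by exact_mod_cast a2
    have a4 : L / Real.log y < j * (M + 1) := lt_of_lt_of_le a1 a3
    rw [div_lt_iff₀ hly] at a4
    rw [div_le_iff₀ (by positivity)]
    nlinarith
  set R : ℝ := 2 * C * (N / L ^ 2) with hR
  have hR0 : 0 ≤ R := by positivity
  have hRb : ∀ h : ℕ, h ≠ 0 → (pairs h (N + 1) : ℝ) ≤ R * sig h := by
    intro h hh
    refine (hsieve (N + 1) (by omega) h hh).trans ?_
    have hs := one_le_sig h hh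
    have hLL : L ≤ Real.log ((N + 1 : ℕ) : ℝ) := Real.log_le_log hN0 (by push_cast; linarith)
    have : ((N + 1 : ℕ) : ℝ) / (Real.log ((N + 1 : ℕ) : ℝ)) ^ 2 ≤ 2 * (N / L ^ 2) := by
      rw [mul_div_assoc']
      have hN1' : (1 : ℝ) ≤ N := by exact_mod_cast hN1
      apply div_le_div₀ (by positivity) (by push_cast; linarith) (by positivity)
      gcongr
    have h5 : C * (((N + 1 : ℕ) : ℝ) / (Real.log ((N + 1 : ℕ) : ℝ)) ^ 2) ≤ R := by
      rw [hR]
      calc _ ≤ C * (2 * (N / L ^ 2)) := by gcongr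
        _ = _ := by ring
    exact mul_le_mul_of_nonneg_right h5 (by linarith)
  have key := main_ineq hy j hj.le N M hN1 hj1 hMk R hR0 hRb
  have hlow : c₁ * N ≤ (Nat.primeCounting N : ℝ) * M := by
    calc c₁ * N = (N / L / 4) * (L / (2 * (j * Real.log y))) := by
          rw [hc₁]; field_simp; norm_num
      _ ≤ _ := by
          gcongr
          exact pi_lower N hN
  have hup : (M : ℝ) * (Nat.primeCounting N + R * fN N y) ≤ E * N := by
    calc (M : ℝ) * (Nat.primeCounting N + R * fN N y)
        ≤ M * ((Real.log 4 + 1) * N / L + R * (C₀ * L)) := by gcongr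
      _ ≤ (L / Real.log y) * ((Real.log 4 + 1) * N / L + R * (C₀ * L)) := by
          gcongr
      _ = E * N := by
          rw [hE, hR]; field_simp
  have h6 : (c₁ * N) ^ 2 ≤ A y (2 * N) * (E * N) :=
    calc (c₁ * N) ^ 2 ≤ ((Nat.primeCounting N : ℝ) * M) ^ 2 := by gcongr
      _ ≤ _ := key
      _ ≤ _ := by gcongr
  rw [div_mul_eq_mul_div, div_le_iff₀ hE0]
  have h7 : (c₁ ^ 2 * N) * N ≤ (A y (2 * N) * E) * N := by
    calc _ = (c₁ * N) ^ 2 := by ring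
      _ ≤ _ := h6
      _ = _ := by ring
  exact le_of_mul_le_mul_right h7 hN0

theorem delta_pos {y : ℝ} (hy : 1 < y) (hf : f y < ⊤) : 0 < delta y := by
  obtain ⟨c, hc, h⟩ := dens hy hf
  refine lt_of_lt_of_le (show 0 < c / 4 by positivity) ?_
  unfold delta
  apply le_liminf_of_le
  · apply IsBoundedUnder.isCoboundedUnder_ge
    refine isBoundedUnder_of ⟨1, fun N => ?_⟩
    apply div_le_one_of_le₀ _ (by positivity)
    exact_mod_cast A_le y N
  · have hhalf : Tendsto (fun N : ℕ => N / 2) atTop atTop := Nat.tendsto_div_const_atTop (by norm_num)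
    filter_upwards [hhalf.eventually h, eventually_ge_atTop 2] with N hN hN2
    have hN0 : (0 : ℝ) < N := by exact_mod_cast (by omega : 0 < N)
    rw [le_div_iff₀ hN0]
    have h1 : (A y (2 * (N / 2)) : ℝ) ≤ A y N := by
      exact_mod_cast A_mono y (Nat.mul_div_le N 2)
    have h2 : (N : ℝ) ≤ 4 * (N / 2 : ℕ) := by exact_mod_cast (by omega : N ≤ 4 * (N / 2))
    change c / 4 * N ≤ A y N
    nlinarith

end Rom

/-- If `y > 1` and `f(y) = limsup_{N→∞} fN(y)/log N < ∞`, then `δ_y > 0`;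
equivalently, `𝒴 = {y > 1 : δ_y = 0} ⊆ ℰ = {y > 1 : f(y) = ∞}`. -/
theorem stmt2 :
    (∀ y : ℝ, 1 < y → f y < ⊤ → 0 < delta y) ∧
      {y : ℝ | 1 < y ∧ delta y = 0} ⊆ {y : ℝ | 1 < y ∧ f y = ⊤} := by
  refine ⟨fun y hy hf => Rom.delta_pos hy hf, ?_⟩
  rintro y ⟨hy, hd⟩
  refine ⟨hy, ?_⟩
  by_contra hne
  have := Rom.delta_pos hy (lt_top_iff_ne_top.2 hne)
  rw [hd] at this
  exact lt_irrefl _ this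
end

section
/- Let n ≥ 3 and N ≥ 2 be integers, and set 𝒩_{n,N} = {y ∈ (1 + 1/n, n) : there exists a positive integer k with k ≤ log N / log y such that y^k is an integer} and ℒ_{n,N} = (1 + 1/n, n) \ 𝒩_{n,N}. Then the restriction of f_N to ℒ_{n,N} is locally constant: for every y₀ ∈ ℒ_{n,N} there exists ε₀ > 0 such that f_N(y) = f_N(y₀) for all y ∈ (y₀ − ε₀, y₀ + ε₀) ∩ ℒ_{n,N}. In particular, f_N restricted to ℒ_{n,N} is continuous. -/
open MeasureTheory Filter

/-- `Nset n N` is the set of `y ∈ (1 + 1/n, n)` such that `y^k` is an integer for some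
positive integer `k ≤ log N / log y`. -/
def Nset (n N : ℕ) : Set ℝ :=
  {y ∈ Set.Ioo (1 + 1 / (n : ℝ)) (n : ℝ) |
    ∃ k : ℕ, 1 ≤ k ∧ (k : ℝ) ≤ Real.log N / Real.log y ∧ ∃ m : ℤ, y ^ k = (m : ℝ)}

lemma le_log_iff (N k : ℕ) (hN : 2 ≤ N) (y : ℝ) (hy : 1 < y) :
    (k : ℝ) ≤ Real.log N / Real.log y ↔ y ^ k ≤ N := by
  have hN' : (0 : ℝ) < N := by exact_mod_cast (by omega : 0 < N)
  rw [le_div_iff₀ (Real.log_pos hy), ← Real.log_pow,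
    Real.log_le_log_iff (by positivity) hN']

lemma ev_one (N k : ℕ) (y₀ : ℝ) (h : y₀ ^ k ≤ N → ∀ m : ℤ, y₀ ^ k ≠ m) :
    ∀ᶠ y : ℝ in nhds y₀, (y ^ k ≤ N ↔ y₀ ^ k ≤ N) ∧ (y₀ ^ k ≤ N → ⌊y ^ k⌋ = ⌊y₀ ^ k⌋) := by
  have hc : Tendsto (fun y : ℝ => y ^ k) (nhds y₀) (nhds (y₀ ^ k)) :=
    (continuous_pow k).tendsto y₀
  by_cases hle : y₀ ^ k ≤ N
  · have h1 : y₀ ^ k < N := lt_of_le_of_ne hle (by exact_mod_cast h hle N)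
    have h2 : (⌊y₀ ^ k⌋ : ℝ) < y₀ ^ k := lt_of_le_of_ne (Int.floor_le _) (h hle _).symm
    filter_upwards [hc.eventually_lt_const h1, hc.eventually_const_lt h2,
      hc.eventually_lt_const (Int.lt_floor_add_one (y₀ ^ k))] with y a b c
    exact ⟨⟨fun _ => hle, fun _ => a.le⟩, fun _ => Int.floor_eq_iff.2 ⟨b.le, c⟩⟩
  · filter_upwards [hc.eventually_const_lt (not_le.1 hle)] with y a
    exact ⟨⟨fun q => absurd q (not_le.2 a), fun q => absurd q hle⟩, fun q => absurd q hle⟩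

lemma ev_main (n N : ℕ) (hn : 3 ≤ n) (hN : 2 ≤ N) (y₀ : ℝ)
    (h0 : y₀ ∈ Set.Ioo (1 + 1 / (n : ℝ)) (n : ℝ) \ Nset n N) :
    ∀ᶠ y : ℝ in nhds y₀, fN N y = fN N y₀ := by
  have hn0 : (0 : ℝ) < 1 / (n : ℝ) := by
    have : (0 : ℝ) < n := by exact_mod_cast (by omega : 0 < n)
    positivity
  obtain ⟨⟨hl, hu⟩, hnot⟩ := h0
  have h1 : 1 < y₀ := by linarith
  obtain ⟨K, hK⟩ := pow_unbounded_of_one_lt (N : ℝ) (by linarith : 1 < 1 + 1 / (n : ℝ))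
  have hbig : ∀ y : ℝ, 1 + 1 / (n : ℝ) < y → ∀ k, K ≤ k → ¬ y ^ k ≤ N := by
    intro y hy k hk
    rw [not_le]
    calc (N : ℝ) < (1 + 1 / (n : ℝ)) ^ K := hK
      _ ≤ y ^ K := by gcongr
      _ ≤ y ^ k := pow_le_pow_right₀ (by linarith) hk
  have hev : ∀ᶠ y : ℝ in nhds y₀, ∀ k ∈ Finset.Ico 1 K,
      (y ^ k ≤ N ↔ y₀ ^ k ≤ N) ∧ (y₀ ^ k ≤ N → ⌊y ^ k⌋ = ⌊y₀ ^ k⌋) := by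
    rw [Filter.eventually_all_finset]
    intro k hk
    apply ev_one
    intro hle m hm
    exact hnot ⟨⟨hl, hu⟩, k, (Finset.mem_Ico.1 hk).1, (le_log_iff N k hN y₀ h1).2 hle, m, hm⟩
  filter_upwards [hev, lt_mem_nhds hl] with y hy hyl
  have hy1 : 1 < y := by linarith
  have hcnt : ∀ d a, cnt N d a y = cnt N d a y₀ := by
    intro d a
    have : {k : ℕ | 1 ≤ k ∧ (k : ℝ) ≤ Real.log N / Real.log y ∧
        ⌊y ^ k⌋ ≡ (a : ℤ) [ZMOD (d : ℤ)]} = {k : ℕ | 1 ≤ k ∧ (k : ℝ) ≤ Real.log N / Real.log y₀ ∧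
        ⌊y₀ ^ k⌋ ≡ (a : ℤ) [ZMOD (d : ℤ)]} := by
      ext k
      simp only [Set.mem_setOf_eq, le_log_iff N k hN y hy1, le_log_iff N k hN y₀ h1]
      by_cases hk : K ≤ k
      · simp [hbig y hyl k hk, hbig y₀ hl k hk]
      · refine and_congr_right fun hk1 => ?_
        obtain ⟨p, q⟩ := hy k (Finset.mem_Ico.2 ⟨hk1, not_le.1 hk⟩)
        rw [p]
        exact and_congr_right fun r => by rw [q r]
    unfold cnt
    rw [this]
  simp only [fN, hcnt]

/-- For integers `n ≥ 3` and `N ≥ 2`, the function `fN N` restricted to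
`ℒ_{n,N} = (1 + 1/n, n) \ 𝒩_{n,N}` is locally constant; in particular it is continuous
on `ℒ_{n,N}`. -/
theorem stmt7 (n N : ℕ) (hn : 3 ≤ n) (hN : 2 ≤ N) :
    (∀ y₀ ∈ Set.Ioo (1 + 1 / (n : ℝ)) (n : ℝ) \ Nset n N, ∃ ε₀ > (0 : ℝ),
      ∀ y ∈ Set.Ioo (y₀ - ε₀) (y₀ + ε₀) ∩
          (Set.Ioo (1 + 1 / (n : ℝ)) (n : ℝ) \ Nset n N),
        fN N y = fN N y₀) ∧
      ContinuousOn (fN N) (Set.Ioo (1 + 1 / (n : ℝ)) (n : ℝ) \ Nset n N) := by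
  refine ⟨fun y₀ h0 => ?_, fun y₀ h0 => ?_⟩
  · obtain ⟨ε, hε, h⟩ := Metric.eventually_nhds_iff.1 (ev_main n N hn hN y₀ h0)
    refine ⟨ε, hε, fun y hy => h ?_⟩
    rw [← Metric.mem_ball, Real.ball_eq_Ioo]
    exact hy.1
  · apply ContinuousAt.continuousWithinAt
    exact continuousAt_const.congr
      ((ev_main n N hn hN y₀ h0).mono fun y hy => hy.symm)
end

section
/- Let n ≥ 3 be an integer and let ℒ_n = (1 + 1/n, n) \ ⋃_{N=1}^{∞} 𝒩_{n,N}, where 𝒩_{n,N} = {y ∈ (1 + 1/n, n) : there exists a positive integer k with k ≤ log N / log y such that y^k is an integer}. Then the set 𝒟_n = {y ∈ ℒ_n : f(y) = ∞} is Lebesgue measurable and has Lebesgue measure zero. -/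
open MeasureTheory Filter

/-- `Ln n = (1 + 1/n, n) \ ⋃_{N=1}^{∞} 𝒩_{n,N}`. -/
def Ln (n : ℕ) : Set ℝ :=
  Set.Ioo (1 + 1 / (n : ℝ)) (n : ℝ) \ ⋃ N ∈ Set.Ici 1, Nset n N

lemma vol_expand (E F : Set ℝ) (T : ℝ → ℝ) (hT : ∀ y ∈ E, T y ∈ F)
    (h : ∀ y ∈ E, ∀ z ∈ E, y < z → z - y ≤ T z - T y) : volume E ≤ volume F := by
  have hinj : Set.InjOn T E := by
    intro y hy z hz e
    rcases lt_trichotomy y z with h1 | h1 | h1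
    · have := h y hy z hz h1; linarith
    · exact h1
    · have := h z hz y hy h1; linarith
  have hlip : LipschitzOnWith 1 (Function.invFunOn T E) (T '' E) := by
    apply LipschitzOnWith.of_dist_le_mul
    rintro _ ⟨y, hy, rfl⟩ _ ⟨z, hz, rfl⟩
    rw [hinj.leftInvOn_invFunOn hy, hinj.leftInvOn_invFunOn hz, Real.dist_eq, Real.dist_eq]
    simp only [NNReal.coe_one, one_mul]
    rcases lt_trichotomy y z with h1 | h1 | h1
    · have := h y hy z hz h1
      rw [abs_of_nonpos (by linarith), abs_of_nonpos (by linarith)]; linarith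
    · subst h1; simp
    · have := h z hz y hy h1
      rw [abs_of_nonneg (by linarith), abs_of_nonneg (by linarith)]; linarith
  have h1 := hlip.hausdorffMeasure_image_le (d := 1) zero_le_one
  have h2 : Function.invFunOn T E '' (T '' E) = E := hinj.invFunOn_image (Set.Subset.refl _)
  rw [h2] at h1
  simp only [MeasureTheory.hausdorffMeasure_real] at h1
  calc volume E ≤ _ := h1
    _ = volume (T '' E) := by simp
    _ ≤ volume F := measure_mono (by rintro _ ⟨y, hy, rfl⟩; exact hT y hy)

lemma key (φ : ℝ → ℝ) (α β ρ : ℝ) (hαβ : α ≤ β) (hc : Continuous φ)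
    (hconv : ConvexOn ℝ (Set.Ici α) φ) (hρ : 0 < ρ)
    (hgrow : ∀ x y, α ≤ x → x ≤ y → ρ * (y - x) ≤ φ y - φ x) (d : ℕ) (hd : 0 < d) (a : ℤ) :
    volume.real {y ∈ Set.Ico α β | ⌊φ y⌋ ≡ a [ZMOD (d : ℤ)]} ≤ (β - α) / d + 1 / ρ := by
  set E : ℕ → Set ℝ := fun s => {y ∈ Set.Ico α β | ⌊φ y⌋ ≡ a - s [ZMOD (d : ℤ)]} with hE
  have hEm : ∀ s, MeasurableSet (E s) := by
    intro s
    apply MeasurableSet.inter measurableSet_Ico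
    have : Measurable fun y => ⌊φ y⌋ := hc.measurable.floor
    exact this (MeasurableSet.of_discrete (s := {z : ℤ | z ≡ a - s [ZMOD (d : ℤ)]}))
  have hEfin : ∀ s, volume (E s) ≠ ⊤ := fun s =>
    ((measure_mono (Set.inter_subset_left)).trans_lt (by simp : volume (Set.Ico α β) < ⊤)).ne
  have hmono : ∀ x y, α ≤ x → x < y → φ x < φ y := by
    intro x y hx hxy
    have := hgrow x y hx hxy.le
    have : 0 < ρ * (y - x) := mul_pos hρ (by linarith)
    linarith
  have hmono' : ∀ x y, α ≤ x → α ≤ y → φ x < φ y → x < y := by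
    intro x y hx hy h
    by_contra hcon
    push Not at hcon
    have := hgrow y x hy hcon
    have : 0 ≤ ρ * (x - y) := mul_nonneg hρ.le (by linarith)
    linarith
  have hstep : ∀ s ∈ Finset.range d, volume.real (E 0) ≤ volume.real (E s) + 1 / ρ := by
    intro s hs
    have hsd : s < d := by simpa using hs
    set E1 := {y ∈ E 0 | φ α + s ≤ φ y}
    set E2 := {y ∈ E 0 | φ y < φ α + s}
    have hcov : E 0 ⊆ E1 ∪ E2 := by
      intro y hy
      rcases le_or_gt (φ α + s) (φ y) with h | h
      · exact Or.inl ⟨hy, h⟩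
      · exact Or.inr ⟨hy, h⟩
    have h1 : volume E1 ≤ volume (E s) := by
      have : ∀ y : ℝ, ∃ x : ℝ, y ∈ E1 → α ≤ x ∧ x ≤ y ∧ φ x = φ y - s := by
        intro y
        by_cases hy : y ∈ E1
        · have hαy : α ≤ y := hy.1.1.1
          have : φ y - s ∈ Set.Icc (φ α) (φ y) := ⟨by linarith [hy.2], by
            have : (0:ℝ) ≤ s := by positivity
            linarith⟩
          obtain ⟨x, hx, hxe⟩ := intermediate_value_Icc hαy hc.continuousOn this
          exact ⟨x, fun _ => ⟨hx.1, hx.2, hxe⟩⟩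
        · exact ⟨0, fun h => absurd h hy⟩
      choose T hT using this
      apply vol_expand E1 (E s) T
      · intro y hy
        obtain ⟨t1, t2, t3⟩ := hT y hy
        refine ⟨⟨t1, lt_of_le_of_lt t2 hy.1.1.2⟩, ?_⟩
        rw [t3]
        have h0 : ⌊φ y⌋ ≡ a - (0:ℕ) [ZMOD (d : ℤ)] := hy.1.2
        have : ⌊φ y - (s:ℝ)⌋ = ⌊φ y⌋ - s := by
          exact_mod_cast Int.floor_sub_intCast (φ y) (s : ℤ)
        rw [this]
        simpa using h0.sub_right (s : ℤ)
      · intro y hy z hz hyz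
        obtain ⟨t1, t2, t3⟩ := hT y hy
        obtain ⟨u1, u2, u3⟩ := hT z hz
        have hαy : α ≤ y := hy.1.1.1
        have hlt : T y < T z := by
          apply hmono' _ _ t1 u1
          have := hmono y z hαy hyz
          linarith
        -- slopes
        have e : φ (T z) - φ (T y) = φ z - φ y := by linarith
        have s1 : (φ (T z) - φ (T y)) / (T z - T y) ≤ (φ z - φ (T y)) / (z - T y) :=
          hconv.secant_mono (a := T y) (x := T z) (y := z) t1 u1 (by simp; linarith)
            hlt.ne' (by linarith) u2
        have s2 : (φ (T y) - φ z) / (T y - z) ≤ (φ y - φ z) / (y - z) :=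
          hconv.secant_mono (a := z) (x := T y) (y := y) (by simp; linarith) t1 (by simpa using hαy)
            (by linarith) hyz.ne t2
        have s3 : (φ (T y) - φ z) / (T y - z) = (φ z - φ (T y)) / (z - T y) := by
          rw [← neg_div_neg_eq]; ring_nf
        have s4 : (φ y - φ z) / (y - z) = (φ z - φ y) / (z - y) := by
          rw [← neg_div_neg_eq]; ring_nf
        rw [s3, s4] at s2
        have s5 := s1.trans s2
        rw [e] at s5
        have hpos : 0 < φ z - φ y := by linarith [hmono y z hαy hyz]
        rwa [div_le_div_iff_of_pos_left hpos (by linarith) (by linarith)] at s5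
    have h2 : volume E2 ≤ ENNReal.ofReal (1 / ρ) := by
      refine (Real.volume_le_diam E2).trans ?_
      apply Metric.ediam_le
      have main : ∀ x ∈ E2, ∀ y ∈ E2, x ≤ y → y - x ≤ 1 / ρ := by
        intro x hx y hy hxy
        have hαx : α ≤ x := hx.1.1.1
        have hαy : α ≤ y := hy.1.1.1
        have hb : ∀ x ∈ E2, ⌊φ α⌋ ≤ ⌊φ x⌋ ∧ ⌊φ x⌋ < ⌊φ α⌋ + d := by
          intro x hx
          have hαx : α ≤ x := hx.1.1.1
          constructor
          · apply Int.floor_le_floor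
            have := hgrow α x le_rfl hαx
            have : 0 ≤ ρ * (x - α) := mul_nonneg hρ.le (by linarith)
            linarith
          · have h1 : ⌊φ x⌋ ≤ ⌊φ α + s⌋ := Int.floor_le_floor hx.2.le
            have : ⌊φ α + (s:ℝ)⌋ = ⌊φ α⌋ + s := by
              exact_mod_cast Int.floor_add_intCast (φ α) (s : ℤ)
            omega
        have hcong : ⌊φ x⌋ ≡ ⌊φ y⌋ [ZMOD (d:ℤ)] := hx.1.2.trans hy.1.2.symm
        have heq : ⌊φ x⌋ = ⌊φ y⌋ := by
          obtain ⟨q, hq⟩ := hcong.dvd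
          have b1 := hb x hx
          have b2 := hb y hy
          have : q = 0 := by
            have hd' : (0:ℤ) < d := by exact_mod_cast hd
            have l1 : (d:ℤ) * q < d * 1 := by linarith
            have l2 : (d:ℤ) * (-1) < d * q := by linarith
            have := lt_of_mul_lt_mul_left l1 hd'.le
            have := lt_of_mul_lt_mul_left l2 hd'.le
            omega
          subst this; linarith
        have g := hgrow x y hαx hxy
        have f1 := Int.lt_floor_add_one (φ y)
        have f2 := Int.floor_le (φ x)
        rw [heq] at f2
        rw [le_div_iff₀ hρ]; nlinarith
      intro x hx y hy
      rw [edist_dist]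
      apply ENNReal.ofReal_le_ofReal
      rw [Real.dist_eq]
      rcases le_total x y with h | h
      · rw [abs_of_nonpos (by linarith)]; linarith [main x hx y hy h]
      · rw [abs_of_nonneg (by linarith)]; linarith [main y hy x hx h]
    have h3 : volume (E 0) ≤ volume (E s) + ENNReal.ofReal (1 / ρ) :=
      (measure_mono hcov).trans ((measure_union_le _ _).trans (add_le_add h1 h2))
    have := ENNReal.toReal_mono (by simp [hEfin s]) h3
    rw [ENNReal.toReal_add (hEfin s) (by simp), ENNReal.toReal_ofReal (by positivity)] at this
    exact this
  have hsum := Finset.sum_le_sum hstep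
  rw [Finset.sum_add_distrib] at hsum
  simp only [Finset.sum_const, Finset.card_range, nsmul_eq_mul] at hsum
  have hdisj : ∑ s ∈ Finset.range d, volume.real (E s) ≤ β - α := by
    rw [← measureReal_biUnion_finset (h := fun s _ => hEfin s)]
    · calc _ ≤ volume.real (Set.Ico α β) := measureReal_mono (by
            intro y hy
            simp only [Set.mem_iUnion] at hy
            obtain ⟨s, _, hs⟩ := hy
            exact hs.1) (by simp)
        _ = β - α := by simp [hαβ]
    · intro s hs t ht hst
      rw [Function.onFun, Set.disjoint_left]
      intro y hy hy'
      apply hst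
      have h1 : a - s ≡ a - t [ZMOD (d:ℤ)] := hy.2.symm.trans hy'.2
      have h2 : (t:ℤ) ≡ s [ZMOD (d:ℤ)] := by
        have := (Int.ModEq.refl a).sub h1
        simpa using this.symm
      have h3 : t ≡ s [MOD d] := by exact_mod_cast (Int.natCast_modEq_iff).1 h2
      simp at hs ht
      exact (Nat.ModEq.eq_of_lt_of_lt h3 ht hs).symm
    · intro s _; exact hEm s
  have h0 : {y ∈ Set.Ico α β | ⌊φ y⌋ ≡ a [ZMOD (d : ℤ)]} = E 0 := by simp [hE]
  rw [h0]
  have hd' : (0:ℝ) < d := by exact_mod_cast hd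
  rw [div_add' _ _ _ hd'.ne', le_div_iff₀ hd']
  linarith

lemma pow_lower (l : ℕ) (α x y : ℝ) (hα : 0 ≤ α) (hx : α ≤ x) (hxy : x ≤ y) :
    (l * α ^ (l - 1)) * (y - x) ≤ y ^ l - x ^ l := by
  rw [← (Commute.all y x).geom_sum₂_mul l]
  apply mul_le_mul_of_nonneg_right _ (by linarith)
  have : ∀ i ∈ Finset.range l, α ^ (l - 1) ≤ y ^ i * x ^ (l - 1 - i) := by
    intro i hi
    have hi' : i < l := by simpa using hi
    calc α ^ (l - 1) = α ^ i * α ^ (l - 1 - i) := by rw [← pow_add]; congr 1; omega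
      _ ≤ _ := by
        have hy : 0 ≤ y := by linarith
        gcongr
        linarith
  have := Finset.sum_le_sum this
  simpa using this

lemma pow_upper (l : ℕ) (x y : ℝ) (hx : 0 ≤ x) (hxy : x ≤ y) :
    y ^ l - x ^ l ≤ (l * y ^ (l - 1)) * (y - x) := by
  rw [← (Commute.all y x).geom_sum₂_mul l]
  apply mul_le_mul_of_nonneg_right _ (by linarith)
  have : ∀ i ∈ Finset.range l, y ^ i * x ^ (l - 1 - i) ≤ y ^ (l - 1) := by
    intro i hi
    have hi' : i < l := by simpa using hi
    calc y ^ (l - 1) = y ^ i * y ^ (l - 1 - i) := by rw [← pow_add]; congr 1; omega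
      _ ≥ _ := by
        have hy : 0 ≤ y := by linarith
        gcongr
  have := Finset.sum_le_sum this
  simpa using this

lemma piece (α β : ℝ) (hα : 0 < α) (hαβ : α ≤ β) (k l : ℕ) (hl : 1 ≤ l) (m : ℤ)
    (hm : ∀ y ∈ Set.Ico α β, ⌊y ^ k⌋ = m) (d : ℕ) (hd : 0 < d) :
    volume.real {y ∈ Set.Ico α β | (d : ℤ) ∣ ⌊y ^ l⌋ - ⌊y ^ k⌋} ≤
      (β - α) / d + 1 / (l * α ^ (l - 1)) := by
  have h := key (fun y => y ^ l) α β (l * α ^ (l - 1)) hαβ (by fun_prop)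
    ((convexOn_pow l).subset (fun x hx => hα.le.trans hx) (convex_Ici α)) (by positivity)
    (fun x y hx hxy => pow_lower l α x y hα.le hx hxy) d hd m
  refine le_trans (le_of_eq ?_) h
  congr 1
  ext y
  simp only [Set.mem_ofPred_eq, and_congr_right_iff]
  intro hy
  rw [hm y hy, Int.modEq_comm, Int.modEq_iff_dvd]

lemma pairA (c : ℝ) (hc : 1 < c) (n : ℕ) (hcn : c < n) (k l : ℕ) (hk : 1 ≤ k) (hkl : k < l)
    (d : ℕ) (hd : 0 < d) :
    volume.real {y ∈ Set.Ico c n | (d : ℤ) ∣ ⌊y ^ l⌋ - ⌊y ^ k⌋} ≤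
      (n - c) / d + (n + 1) * (1 / c) ^ (l - k) := by
  set α : ℕ → ℝ := fun m => (m : ℝ) ^ ((k : ℝ)⁻¹) with hα
  have hk0 : k ≠ 0 := by omega
  have hαk : ∀ m, α m ^ k = m := fun m => Real.rpow_inv_natCast_pow (by positivity) hk0
  have hα0 : ∀ m, 0 ≤ α m := fun m => by positivity
  have hαm : ∀ m m', m ≤ m' → α m ≤ α m' := by
    intro m m' h
    apply le_of_pow_le_pow_left₀ hk0 (hα0 _)
    rw [hαk, hαk]; exact_mod_cast h
  set m0 := ⌊c ^ k⌋₊ with hm0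
  have hc0 : 0 < c := by linarith
  have hcα : ∀ m, m0 + 1 ≤ m → c < α m := by
    intro m h
    apply lt_of_pow_lt_pow_left₀ k (hα0 _)
    rw [hαk]
    have h1 := Nat.lt_floor_add_one (c ^ k)
    have h2 : ((m0 + 1 : ℕ) : ℝ) ≤ m := by exact_mod_cast h
    push_cast at h2
    linarith
  have hfl : ∀ (m : ℕ) (y : ℝ), 0 ≤ y → (m : ℝ) ≤ y ^ k → y < α (m + 1) → ⌊y ^ k⌋ = m := by
    intro m y h0 h1 h2
    rw [Int.floor_eq_iff]
    refine ⟨by exact_mod_cast h1, ?_⟩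
    have := pow_lt_pow_left₀ h2 h0 hk0
    rw [hαk] at this
    push_cast at this ⊢; exact this
  have hind : ∀ i : ℕ, volume.real {y ∈ Set.Ico c (α (m0 + i + 1)) | (d : ℤ) ∣ ⌊y ^ l⌋ - ⌊y ^ k⌋} ≤
      (α (m0 + i + 1) - c) / d + (1 / c) ^ (l - k) + (1 / c) ^ (l - k) * (α (m0 + i) - α m0) := by
    intro i
    induction i with
    | zero =>
      have h := piece c (α (m0 + 1)) hc0 (hcα _ le_rfl).le k l (by omega) m0 (by
        intro y hy
        apply hfl m0 y (by linarith [hy.1]) _ hy.2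
        exact (Nat.floor_le (by positivity)).trans (pow_le_pow_left₀ hc0.le hy.1 k)) d hd
      simp only [add_zero, sub_self, mul_zero]
      refine h.trans ?_
      have : 1 / (l * c ^ (l - 1)) ≤ (1 / c) ^ (l - k) := by
        rw [one_div_pow]
        apply one_div_le_one_div_of_le (by positivity)
        have h1 : c ^ (l - k) ≤ c ^ (l - 1) := pow_le_pow_right₀ hc.le (by omega)
        have h2 : (1:ℝ) ≤ l := by exact_mod_cast (by omega : 1 ≤ l)
        have h3 : 0 < c ^ (l - 1) := by positivity
        nlinarith
      linarith
    | succ i ih =>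
      set M := m0 + i + 1 with hM
      have e1 : m0 + (i + 1) = M := by omega
      rw [e1]
      have hcM := hcα M (by omega)
      have hMM := hαm M (M + 1) (by omega)
      have h := piece (α M) (α (M + 1)) (by linarith) hMM k l (by omega) M (by
        intro y hy
        apply hfl M y (by linarith [hy.1]) _ hy.2
        rw [← hαk M]
        exact pow_le_pow_left₀ (hα0 _) hy.1 k) d hd
      have hcov : {y ∈ Set.Ico c (α (M + 1)) | (d : ℤ) ∣ ⌊y ^ l⌋ - ⌊y ^ k⌋} ⊆
          {y ∈ Set.Ico c (α M) | (d : ℤ) ∣ ⌊y ^ l⌋ - ⌊y ^ k⌋} ∪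
          {y ∈ Set.Ico (α M) (α (M + 1)) | (d : ℤ) ∣ ⌊y ^ l⌋ - ⌊y ^ k⌋} := by
        rintro y ⟨⟨h1, h2⟩, h3⟩
        rcases lt_or_ge y (α M) with h4 | h4
        · exact Or.inl ⟨⟨h1, h4⟩, h3⟩
        · exact Or.inr ⟨⟨h4, h2⟩, h3⟩
      have hle := (measureReal_mono (μ := volume) hcov (by
        apply ne_of_lt
        refine (measure_union_le _ _).trans_lt ?_
        apply ENNReal.add_lt_top.2
        constructor
        · exact (measure_mono Set.inter_subset_left).trans_lt (by simp : volume (Set.Ico _ _) < ⊤)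
        · exact (measure_mono Set.inter_subset_left).trans_lt
            (by simp : volume (Set.Ico _ _) < ⊤))).trans (measureReal_union_le _ _)
      have herr : 1 / (l * α M ^ (l - 1)) ≤ (1 / c) ^ (l - k) * (α M - α (m0 + i)) := by
        have hαM : 0 < α M := by linarith
        have u := pow_upper k (α (m0 + i)) (α M) (hα0 _) (hαm _ _ (by omega))
        rw [hαk, hαk, hM] at u
        push_cast at u
        have u' : 1 ≤ (k * α M ^ (k - 1)) * (α M - α (m0 + i)) := by rw [hM]; linarith
        have hdiff : 0 ≤ α M - α (m0 + i) := by linarith [hαm (m0 + i) M (by omega)]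
        rw [one_div_pow, div_mul_eq_mul_div, one_mul]
        have hl0 : (0:ℝ) < l := by exact_mod_cast (by omega : 0 < l)
        rw [div_le_div_iff₀ (by positivity) (by positivity)]
        have e : α M ^ (l - 1) = α M ^ (l - k) * α M ^ (k - 1) := by
          rw [← pow_add]; congr 1; omega
        have hcp : c ^ (l - k) ≤ α M ^ (l - k) := pow_le_pow_left₀ hc0.le hcM.le _
        have hkl' : (k:ℝ) ≤ l := by exact_mod_cast hkl.le
        calc 1 * c ^ (l - k) ≤ ((k * α M ^ (k - 1)) * (α M - α (m0 + i))) * α M ^ (l - k) := by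
              gcongr
          _ ≤ ((l * α M ^ (k - 1)) * (α M - α (m0 + i))) * α M ^ (l - k) := by gcongr
          _ = _ := by rw [e]; ring
      have e2 : (α (M + 1) - c) / d = (α M - c) / d + (α (M + 1) - α M) / d := by ring
      rw [e2]
      have : (1 / c) ^ (l - k) * (α M - α m0) = (1 / c) ^ (l - k) * (α M - α (m0 + i))
        + (1 / c) ^ (l - k) * (α (m0 + i) - α m0) := by ring
      linarith
  have hlt : m0 < n ^ k := by
    rw [hm0, Nat.floor_lt (by positivity)]
    push_cast
    exact pow_lt_pow_left₀ hcn hc0.le hk0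
  have hαn : α (n ^ k) = n := by
    rw [hα]; simp only; push_cast
    exact Real.pow_rpow_inv_natCast (by positivity) hk0
  have h := hind (n ^ k - m0 - 1)
  have e3 : m0 + (n ^ k - m0 - 1) + 1 = n ^ k := by omega
  rw [e3, hαn] at h
  refine h.trans ?_
  have h1 := hαm (m0 + (n ^ k - m0 - 1)) (n ^ k) (by omega)
  rw [hαn] at h1
  have h2 := hα0 m0
  have h3 : 0 ≤ (1 / c) ^ (l - k) := by positivity
  nlinarith

lemma pairB (c : ℝ) (hc : 1 < c) (n : ℕ) (hcn : c < n) (k l : ℕ) (hk : 1 ≤ k) (hkl : k < l)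
    (d : ℕ) (hd : 0 < d) :
    volume.real {y ∈ Set.Ico c n | (d : ℤ) ∣ ⌊y ^ l⌋ - ⌊y ^ k⌋} ≤
      2 * ((n - c) / d + 1 / c ^ (l - 1)) := by
  have hc0 : 0 < c := by linarith
  have hgr : ∀ x y : ℝ, c ≤ x → x ≤ y →
      c ^ (l - 1) * (y - x) ≤ (y ^ l - y ^ k) - (x ^ l - x ^ k) := by
    intro x y hx hxy
    obtain ⟨j, rfl⟩ : ∃ j, l = k + (j + 1) := ⟨l - k - 1, by omega⟩
    have h1 := pow_lower (j + 1) x x y (by linarith) le_rfl hxy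
    have h2 : x ^ k ≤ y ^ k := pow_le_pow_left₀ (by linarith) hxy k
    have h3 : 1 ≤ y ^ (j + 1) := one_le_pow₀ (by linarith)
    have h4 : c ^ (k + (j + 1) - 1) ≤ x ^ k * x ^ j := by
      rw [← pow_add]; exact pow_le_pow_left₀ hc0.le hx _
    have h5 : 0 < x ^ k := pow_pos (by linarith) k
    have h6 : 0 < x ^ j := pow_pos (by linarith) j
    have h7 : x ^ j * (y - x) ≤ y ^ (j + 1) - x ^ (j + 1) := by
      refine le_trans ?_ h1
      apply mul_le_mul_of_nonneg_right _ (by linarith)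
      simp only [Nat.add_sub_cancel]; push_cast
      have : (0:ℝ) ≤ j := by positivity
      nlinarith
    calc _ ≤ (x ^ k * x ^ j) * (y - x) := mul_le_mul_of_nonneg_right h4 (by linarith)
      _ = x ^ k * (x ^ j * (y - x)) := by ring
      _ ≤ x ^ k * (y ^ (j + 1) - x ^ (j + 1)) := by gcongr
      _ ≤ x ^ k * (y ^ (j + 1) - x ^ (j + 1)) + (y ^ k - x ^ k) * (y ^ (j + 1) - 1) :=
        le_add_of_nonneg_right (mul_nonneg (by linarith) (by linarith))
      _ = _ := by ring
  have hconv : ConvexOn ℝ (Set.Ici c) (fun y : ℝ => y ^ l - y ^ k) := by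
    have e : (fun y : ℝ => y ^ l - y ^ k) = (fun y : ℝ => y ^ k) * (fun y : ℝ => y ^ (l - k) - 1) := by
      ext y
      simp only [Pi.mul_apply]
      rw [mul_sub, ← pow_add]; congr 2; omega; simp
    rw [e]
    have hsub : Set.Ici c ⊆ Set.Ici 0 := fun x hx => hc0.le.trans hx
    apply ConvexOn.mul ((convexOn_pow k).subset hsub (convex_Ici c))
      (((convexOn_pow (l - k)).subset hsub (convex_Ici c)).sub (concaveOn_const 1 (convex_Ici c)))
    · intro x hx; exact pow_nonneg (hsub hx) k
    · intro x hx
      have : 1 ≤ x ^ (l - k) := one_le_pow₀ (by have : c ≤ x := hx; linarith)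
      simpa using this
    · apply MonotoneOn.monovaryOn
      · intro x hx y hy hxy; exact pow_le_pow_left₀ (hsub hx) hxy k
      · intro x hx y hy hxy
        simpa using pow_le_pow_left₀ (hsub hx) hxy (l - k)
  have hk1 := fun a => key (fun y : ℝ => y ^ l - y ^ k) c n (c ^ (l - 1)) hcn.le (by fun_prop) hconv
    (by positivity) hgr d hd a
  have hcov : {y ∈ Set.Ico c (n:ℝ) | (d : ℤ) ∣ ⌊y ^ l⌋ - ⌊y ^ k⌋} ⊆
      {y ∈ Set.Ico c (n:ℝ) | ⌊y ^ l - y ^ k⌋ ≡ 0 [ZMOD (d : ℤ)]} ∪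
      {y ∈ Set.Ico c (n:ℝ) | ⌊y ^ l - y ^ k⌋ ≡ -1 [ZMOD (d : ℤ)]} := by
    rintro y ⟨h1, h2⟩
    have a1 := Int.floor_le (y ^ l)
    have a2 := Int.lt_floor_add_one (y ^ l)
    have a3 := Int.floor_le (y ^ k)
    have a4 := Int.lt_floor_add_one (y ^ k)
    have h3 : ⌊y ^ l - y ^ k⌋ = ⌊y ^ l⌋ - ⌊y ^ k⌋ ∨ ⌊y ^ l - y ^ k⌋ = ⌊y ^ l⌋ - ⌊y ^ k⌋ - 1 := by
      rcases le_or_gt ((⌊y ^ l⌋ - ⌊y ^ k⌋ : ℤ) : ℝ) (y ^ l - y ^ k) with h | h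
      · left; rw [Int.floor_eq_iff]; push_cast at h ⊢; constructor <;> linarith
      · right; rw [Int.floor_eq_iff]; push_cast at h ⊢; constructor <;> linarith
    rcases h3 with h3 | h3
    · left; refine ⟨h1, ?_⟩
      rw [h3]; exact (Int.modEq_zero_iff_dvd).2 h2
    · right; refine ⟨h1, ?_⟩
      rw [h3]
      have := ((Int.modEq_zero_iff_dvd).2 h2).sub_right 1
      simpa using this
  have hle := (measureReal_mono (μ := volume) hcov (by
    apply ne_of_lt
    refine (measure_union_le _ _).trans_lt ?_
    apply ENNReal.add_lt_top.2
    constructor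
    · exact (measure_mono Set.inter_subset_left).trans_lt (by simp : volume (Set.Ico _ _) < ⊤)
    · exact (measure_mono Set.inter_subset_left).trans_lt
        (by simp : volume (Set.Ico _ _) < ⊤))).trans (measureReal_union_le _ _)
  linarith [hk1 0, hk1 (-1)]

/-- Indicator of a coincidence modulo `d`. -/
noncomputable def gg (d k l : ℕ) (y : ℝ) : ℝ := if (d : ℤ) ∣ ⌊y ^ l⌋ - ⌊y ^ k⌋ then 1 else 0

lemma gg_nonneg (d k l : ℕ) (y : ℝ) : 0 ≤ gg d k l y := by unfold gg; split_ifs <;> norm_num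

lemma gg_zmod (d k l : ℕ) (y : ℝ) :
    gg d k l y = if ((⌊y ^ k⌋ : ℤ) : ZMod d) = ((⌊y ^ l⌋ : ℤ) : ZMod d) then 1 else 0 := by
  unfold gg
  simp only [ZMod.intCast_eq_intCast_iff_dvd_sub]

lemma var_bound (d : ℕ) [NeZero d] (s : Finset ℕ) (A : ℕ → ZMod d) (a : ZMod d) :
    ((∑ k ∈ s, if A k = a then (1:ℝ) else 0) - s.card / d) ^ 2 ≤
      (∑ k ∈ s, ∑ l ∈ s, if A k = A l then (1:ℝ) else 0) - (s.card : ℝ) ^ 2 / d := by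
  set C : ZMod d → ℝ := fun a => ∑ k ∈ s, if A k = a then (1:ℝ) else 0 with hC
  have hd : (d:ℝ) ≠ 0 := by exact_mod_cast NeZero.ne d
  have h1 : ∑ a, C a = s.card := by
    simp only [hC]
    rw [Finset.sum_comm]
    simp
  have h2 : ∑ a, C a ^ 2 = ∑ k ∈ s, ∑ l ∈ s, if A k = A l then (1:ℝ) else 0 := by
    simp only [hC, sq, Finset.sum_mul_sum]
    rw [Finset.sum_comm]
    apply Finset.sum_congr rfl
    intro k _
    rw [Finset.sum_comm]
    apply Finset.sum_congr rfl
    intro l _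
    simp [eq_comm]
  have h3 : ∑ a, (C a - s.card / d) ^ 2 =
      (∑ k ∈ s, ∑ l ∈ s, if A k = A l then (1:ℝ) else 0) - (s.card : ℝ) ^ 2 / d := by
    rw [← h2]
    have : ∀ a, (C a - s.card / d) ^ 2 = C a ^ 2 - (2 * (s.card / d)) * C a + (s.card / d : ℝ) ^ 2 := by
      intro a; ring
    simp only [this]
    rw [Finset.sum_add_distrib, Finset.sum_sub_distrib, ← Finset.mul_sum, h1]
    simp only [Finset.sum_const, Finset.card_univ, ZMod.card, nsmul_eq_mul]
    field_simp
    ring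
  rw [← h3]
  exact Finset.single_le_sum (f := fun a => (C a - s.card / d) ^ 2) (fun _ _ => sq_nonneg _)
    (Finset.mem_univ a)

lemma cnt_le (N d a K : ℕ) (y : ℝ) (hK : Real.log N / Real.log y ≤ K) :
    (cnt N d a y : ℝ) ≤ ∑ k ∈ Finset.Icc 1 K, if ((⌊y ^ k⌋ : ℤ) : ZMod d) = (a : ZMod d) then (1:ℝ) else 0 := by
  rw [Finset.sum_boole]
  norm_cast
  unfold cnt
  rw [Nat.card_coe_set_eq, ← Set.ncard_coe_finset]
  apply Set.ncard_le_ncard _ (Finset.finite_toSet _)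
  rintro k ⟨h1, h2, h3⟩
  simp only [Finset.coe_filter, Finset.mem_Icc, Set.mem_ofPred_eq]
  refine ⟨⟨h1, by exact_mod_cast h2.trans hK⟩, ?_⟩
  have := (ZMod.intCast_eq_intCast_iff _ _ _).2 h3
  simpa using this

/-- The variance. -/
noncomputable def VV (d K : ℕ) (y : ℝ) : ℝ :=
  (∑ k ∈ Finset.Icc 1 K, ∑ l ∈ Finset.Icc 1 K, gg d k l y) - (K : ℝ) ^ 2 / d

/-- The number of coincidences beyond `k0`. -/
noncomputable def PP (d k0 K : ℕ) (y : ℝ) : ℝ :=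
  ∑ k ∈ Finset.Icc k0 K, ∑ l ∈ Finset.Ioc k K, gg d k l y

lemma PP_nonneg (d k0 K : ℕ) (y : ℝ) : 0 ≤ PP d k0 K y :=
  Finset.sum_nonneg fun _ _ => Finset.sum_nonneg fun _ _ => gg_nonneg _ _ _ _

lemma VV_bound (d K : ℕ) (hd : 0 < d) (y : ℝ) (a : ZMod d) :
    ((∑ k ∈ Finset.Icc 1 K, if ((⌊y ^ k⌋ : ℤ) : ZMod d) = a then (1:ℝ) else 0) - K / d) ^ 2 ≤
      VV d K y := by
  have : NeZero d := ⟨hd.ne'⟩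
  have := var_bound d (Finset.Icc 1 K) (fun k => ((⌊y ^ k⌋ : ℤ) : ZMod d)) a
  simp only [Nat.card_Icc, Nat.add_sub_cancel] at this
  unfold VV
  simp only [gg_zmod]
  exact this

lemma VV_nonneg (d K : ℕ) (hd : 0 < d) (y : ℝ) : 0 ≤ VV d K y :=
  (sq_nonneg _).trans (VV_bound d K hd y 0)

lemma bound1 (d K : ℕ) (hd : 0 < d) (y t : ℝ) (ht : 0 < t) (a : ZMod d) :
    (∑ k ∈ Finset.Icc 1 K, if ((⌊y ^ k⌋ : ℤ) : ZMod d) = a then (1:ℝ) else 0) ≤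
      K / d + t + VV d K y / t := by
  have h := VV_bound d K hd y a
  set X := (∑ k ∈ Finset.Icc 1 K, if ((⌊y ^ k⌋ : ℤ) : ZMod d) = a then (1:ℝ) else 0) - K / d with hX
  have : X ≤ t + VV d K y / t := by
    have h1 : X ≤ t + X ^ 2 / t := by
      rw [← sub_le_iff_le_add', le_div_iff₀ ht]
      nlinarith [sq_nonneg (X - t)]
    have : X ^ 2 / t ≤ VV d K y / t := by gcongr
    linarith
  linarith

lemma bound2 (d K k0 : ℕ) (y : ℝ) (a : ZMod d) :
    (∑ k ∈ Finset.Icc 1 K, if ((⌊y ^ k⌋ : ℤ) : ZMod d) = a then (1:ℝ) else 0) ≤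
      k0 + 1 + PP d k0 K y := by
  set A : ℕ → ZMod d := fun k => ((⌊y ^ k⌋ : ℤ) : ZMod d) with hA
  have h1 : (∑ k ∈ Finset.Icc 1 K, if A k = a then (1:ℝ) else 0) ≤
      k0 + ∑ k ∈ Finset.Icc k0 K, if A k = a then (1:ℝ) else 0 := by
    have : Finset.Icc 1 K ⊆ Finset.Ico 0 k0 ∪ Finset.Icc k0 K := by
      intro k hk; simp at hk ⊢; omega
    calc _ ≤ ∑ k ∈ Finset.Ico 0 k0 ∪ Finset.Icc k0 K, (if A k = a then (1:ℝ) else 0) :=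
          Finset.sum_le_sum_of_subset_of_nonneg this (fun _ _ _ => by split_ifs <;> norm_num)
      _ = (∑ k ∈ Finset.Ico 0 k0, if A k = a then (1:ℝ) else 0) +
            ∑ k ∈ Finset.Icc k0 K, if A k = a then (1:ℝ) else 0 := by
          rw [Finset.sum_union]
          rw [Finset.disjoint_left]; intro k hk hk'; simp at hk hk'; omega
      _ ≤ _ := by
          gcongr
          calc _ ≤ ∑ k ∈ Finset.Ico 0 k0, (1:ℝ) := Finset.sum_le_sum (fun _ _ => by split_ifs <;> norm_num)
            _ = k0 := by simp
  have h2 : (∑ k ∈ Finset.Icc k0 K, if A k = a then (1:ℝ) else 0) ≤ 1 + PP d k0 K y := by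
    by_cases hT : ((Finset.Icc k0 K).filter (fun k => A k = a)).Nonempty
    · set T := (Finset.Icc k0 K).filter (fun k => A k = a) with hTdef
      set m := T.min' hT
      have hm : m ∈ T := T.min'_mem hT
      have hm' : m ∈ Finset.Icc k0 K ∧ A m = a := by simpa [hTdef] using hm
      have e : (∑ k ∈ Finset.Icc k0 K, if A k = a then (1:ℝ) else 0) = T.card := by
        rw [Finset.sum_boole]
      have hc : T.card ≤ 1 + ((Finset.Ioc m K).filter (fun l => A m = A l)).card := by
        have : T ⊆ {m} ∪ (Finset.Ioc m K).filter (fun l => A m = A l) := by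
          intro k hk
          have hk' : k ∈ Finset.Icc k0 K ∧ A k = a := by simpa [hTdef] using hk
          have hle : m ≤ k := T.min'_le k hk
          rcases hle.eq_or_lt with h | h
          · simp [h]
          · simp only [Finset.mem_union, Finset.mem_filter, Finset.mem_Ioc]
            right
            exact ⟨⟨h, (Finset.mem_Icc.1 hk'.1).2⟩, hm'.2.trans hk'.2.symm⟩
        calc _ ≤ _ := Finset.card_le_card this
          _ ≤ _ := Finset.card_union_le _ _
          _ = _ := by simp
      have hP : (((Finset.Ioc m K).filter (fun l => A m = A l)).card : ℝ) ≤ PP d k0 K y := by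
        rw [← Finset.sum_boole]
        have := Finset.single_le_sum (f := fun k => ∑ l ∈ Finset.Ioc k K, gg d k l y)
          (fun _ _ => Finset.sum_nonneg fun _ _ => gg_nonneg _ _ _ _) hm'.1
        refine le_trans (le_of_eq ?_) this
        simp only [gg_zmod, hA]
      rw [e]
      have : (T.card : ℝ) ≤ 1 + ((Finset.Ioc m K).filter (fun l => A m = A l)).card := by exact_mod_cast hc
      linarith
    · rw [Finset.not_nonempty_iff_eq_empty] at hT
      rw [Finset.sum_boole, hT]
      have := PP_nonneg d k0 K y
      simp; linarith
  linarith

/-- Harmonic numbers over the reals. -/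
noncomputable def HH (m : ℕ) : ℝ := ∑ d ∈ Finset.Icc 1 m, 1 / (d : ℝ)

lemma HH_le (m : ℕ) : HH m ≤ 1 + Real.log m := by
  have := harmonic_le_one_add_log m
  rw [harmonic_eq_sum_Icc] at this
  push_cast at this
  simpa [HH] using this

lemma HH_nonneg (m : ℕ) : 0 ≤ HH m := Finset.sum_nonneg fun _ _ => by positivity

lemma sum_sq_le (m : ℕ) : ∑ d ∈ Finset.Icc 1 m, 1 / (d : ℝ) ^ 2 ≤ 2 - 1 / (m : ℝ) := by
  induction m with
  | zero => simp
  | succ m ih =>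
    rw [Finset.sum_Icc_succ_top (by omega)]
    rcases Nat.eq_zero_or_pos m with h | h
    · subst h; norm_num
    · have hm : (0:ℝ) < m := by exact_mod_cast h
      have : 1 / ((m:ℝ) + 1) ^ 2 ≤ 1 / m - 1 / (m + 1) := by
        rw [div_sub_div _ _ (by positivity) (by positivity), div_le_div_iff₀ (by positivity) (by positivity)]
        nlinarith
      push_cast
      linarith

/-- The remainder. -/
noncomputable def RR (K D N k0 : ℕ) (t : ℝ) (y : ℝ) : ℝ :=
  (∑ d ∈ Finset.Icc 1 D, (1 / (d : ℝ)) * (VV d K y / t)) +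
    ∑ d ∈ (Finset.Icc 1 N).filter (fun d => D < d), (1 / (d : ℝ)) * PP d k0 K y

lemma RR_nonneg (K D N k0 : ℕ) (t : ℝ) (ht : 0 < t) (y : ℝ) : 0 ≤ RR K D N k0 t y := by
  apply add_nonneg
  · apply Finset.sum_nonneg
    intro d hd
    have := VV_nonneg d K (by simp at hd; omega) y
    positivity
  · apply Finset.sum_nonneg
    intro d hd
    have := PP_nonneg d k0 K y
    positivity

lemma fN_le (N K D k0 : ℕ) (t y : ℝ) (ht : 0 < t) (hK : Real.log N / Real.log y ≤ K) :
    fN N y ≤ 2 * K + t * HH D + (k0 + 1) * HH N + RR K D N k0 t y := by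
  have hsup : ∀ d ∈ Finset.Icc 1 N, ∃ a : ZMod d,
      (((Finset.Icc 1 d).sup (fun a => cnt N d a y) : ℕ) : ℝ) ≤
        ∑ k ∈ Finset.Icc 1 K, if ((⌊y ^ k⌋ : ℤ) : ZMod d) = a then (1:ℝ) else 0 := by
    intro d hd
    have hd1 : 1 ≤ d := (Finset.mem_Icc.1 hd).1
    obtain ⟨a, _, ha⟩ := Finset.exists_mem_eq_sup (Finset.Icc 1 d) ⟨1, by simp [hd1]⟩
      (fun a => cnt N d a y)
    exact ⟨a, by rw [ha]; exact cnt_le N d a K y hK⟩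
  unfold fN
  rw [← Finset.sum_filter_add_sum_filter_not (Finset.Icc 1 N) (fun d => D < d)]
  have hA : ∑ d ∈ (Finset.Icc 1 N).filter (fun d => D < d),
      (1 / (d : ℝ)) * (((Finset.Icc 1 d).sup (fun a => cnt N d a y) : ℕ) : ℝ) ≤
      (k0 + 1) * HH N + ∑ d ∈ (Finset.Icc 1 N).filter (fun d => D < d), (1 / (d : ℝ)) * PP d k0 K y := by
    calc _ ≤ ∑ d ∈ (Finset.Icc 1 N).filter (fun d => D < d),
        ((k0 + 1) * (1 / (d : ℝ)) + (1 / (d : ℝ)) * PP d k0 K y) := by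
          apply Finset.sum_le_sum
          intro d hd
          obtain ⟨a, ha⟩ := hsup d (Finset.mem_filter.1 hd).1
          have := ha.trans (bound2 d K k0 y a)
          calc _ ≤ (1 / (d:ℝ)) * (k0 + 1 + PP d k0 K y) := by gcongr
            _ = _ := by ring
      _ ≤ _ := by
          rw [Finset.sum_add_distrib, ← Finset.mul_sum]
          gcongr
          exact Finset.sum_le_sum_of_subset_of_nonneg (Finset.filter_subset _ _) (fun _ _ _ => by positivity)
  have hB : ∑ d ∈ (Finset.Icc 1 N).filter (fun d => ¬ D < d),
      (1 / (d : ℝ)) * (((Finset.Icc 1 d).sup (fun a => cnt N d a y) : ℕ) : ℝ) ≤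
      2 * K + t * HH D + ∑ d ∈ Finset.Icc 1 D, (1 / (d : ℝ)) * (VV d K y / t) := by
    calc _ ≤ ∑ d ∈ (Finset.Icc 1 N).filter (fun d => ¬ D < d),
        (K * (1 / (d : ℝ) ^ 2) + t * (1 / (d : ℝ)) + (1 / (d : ℝ)) * (VV d K y / t)) := by
          apply Finset.sum_le_sum
          intro d hd
          have hd' := (Finset.mem_filter.1 hd).1
          obtain ⟨a, ha⟩ := hsup d hd'
          have := ha.trans (bound1 d K (by simp at hd'; omega) y t ht a)
          calc _ ≤ (1 / (d:ℝ)) * (K / d + t + VV d K y / t) := by gcongr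
            _ = _ := by ring
      _ ≤ ∑ d ∈ Finset.Icc 1 D,
        (K * (1 / (d : ℝ) ^ 2) + t * (1 / (d : ℝ)) + (1 / (d : ℝ)) * (VV d K y / t)) := by
          apply Finset.sum_le_sum_of_subset_of_nonneg
          · intro d hd
            simp only [Finset.mem_filter, Finset.mem_Icc] at hd ⊢
            omega
          · intro d hd _
            have := VV_nonneg d K (by simp at hd; omega) y
            positivity
      _ ≤ _ := by
          rw [Finset.sum_add_distrib, Finset.sum_add_distrib, ← Finset.mul_sum, ← Finset.mul_sum]
          have h1 := sum_sq_le D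
          have h2 : (0:ℝ) ≤ 1 / D := by positivity
          have h3 : (K:ℝ) * ∑ d ∈ Finset.Icc 1 D, 1 / (d:ℝ) ^ 2 ≤ K * 2 := by gcongr; linarith
          unfold HH
          linarith
  unfold RR
  linarith

lemma gg_eq_ind (d k l : ℕ) :
    gg d k l = Set.indicator {y : ℝ | (d : ℤ) ∣ ⌊y ^ l⌋ - ⌊y ^ k⌋} (fun _ => (1:ℝ)) := by
  ext y
  simp [gg, Set.indicator_apply]

lemma gg_set_meas (d k l : ℕ) : MeasurableSet {y : ℝ | (d : ℤ) ∣ ⌊y ^ l⌋ - ⌊y ^ k⌋} := by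
  have h : Measurable fun y : ℝ => ⌊y ^ l⌋ - ⌊y ^ k⌋ := by
    have h1 : Measurable fun y : ℝ => ⌊y ^ l⌋ := (measurable_id.pow_const l).floor
    have h2 : Measurable fun y : ℝ => ⌊y ^ k⌋ := (measurable_id.pow_const k).floor
    exact h1.sub h2
  exact h (MeasurableSet.of_discrete (s := {z : ℤ | (d : ℤ) ∣ z}))

lemma gg_int (d k l : ℕ) (c b : ℝ) : Integrable (gg d k l) (volume.restrict (Set.Ico c b)) := by
  rw [gg_eq_ind]
  exact (integrable_const (1:ℝ)).indicator (gg_set_meas d k l)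

lemma gg_integral (d k l : ℕ) (c b : ℝ) : ∫ y, gg d k l y ∂(volume.restrict (Set.Ico c b)) =
    volume.real {y ∈ Set.Ico c b | (d : ℤ) ∣ ⌊y ^ l⌋ - ⌊y ^ k⌋} := by
  rw [gg_eq_ind, integral_indicator_const _ (gg_set_meas d k l)]
  simp only [smul_eq_mul, mul_one]
  rw [measureReal_restrict_apply (gg_set_meas d k l)]
  congr 1
  ext y
  exact and_comm

lemma gg_bound (c : ℝ) (hc : 1 < c) (n : ℕ) (hcn : c < n) (k l : ℕ) (hk : 1 ≤ k) (hl : 1 ≤ l)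
    (d : ℕ) (hd : 0 < d) : ∫ y, gg d k l y ∂(volume.restrict (Set.Ico c n)) ≤
      (n - c) / d + (n + 1) * (1 / c) ^ ((l - k) + (k - l)) := by
  rcases lt_trichotomy k l with h | h | h
  · rw [gg_integral]
    have := pairA c hc n hcn k l hk h d hd
    rwa [Nat.sub_eq_zero_of_le h.le, add_zero]
  · subst h
    rw [gg_integral]
    have h1 : volume.real {y ∈ Set.Ico c (n:ℝ) | (d : ℤ) ∣ ⌊y ^ k⌋ - ⌊y ^ k⌋} ≤ n - c := by
      calc _ ≤ volume.real (Set.Ico c (n:ℝ)) := measureReal_mono Set.inter_subset_left (by simp)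
        _ = _ := by simp [hcn.le]
    have h2 : 0 ≤ ((n:ℝ) - c) / d := div_nonneg (by linarith) (by positivity)
    simp only [Nat.sub_self, add_zero, pow_zero, mul_one]
    linarith
  · have e : gg d k l = gg d l k := by
      ext y; unfold gg; exact if_congr (dvd_sub_comm) rfl rfl
    rw [e, gg_integral]
    have := pairA c hc n hcn l k hl h d hd
    rwa [Nat.sub_eq_zero_of_le h.le, zero_add]

lemma geo_le (r : ℝ) (hr0 : 0 ≤ r) (hr1 : r < 1) (m : ℕ) : ∑ i ∈ Finset.range m, r ^ i ≤ 1 / (1 - r) := by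
  rw [one_div, ← tsum_geometric_of_lt_one hr0 hr1]
  exact (summable_geometric_of_lt_one hr0 hr1).sum_le_tsum _ (fun _ _ => by positivity)

lemma geo2 (r : ℝ) (hr0 : 0 ≤ r) (hr1 : r < 1) (k K : ℕ) :
    ∑ l ∈ Finset.Icc 1 K, r ^ ((l - k) + (k - l)) ≤ 2 * (1 / (1 - r)) := by
  have hsub : Finset.Icc 1 K ⊆ Finset.range (k + 1) ∪ Finset.Ico k (k + K + 1) := by
    intro l hl; simp at hl ⊢; omega
  have hnn : ∀ i : ℕ, 0 ≤ r ^ i := fun i => by positivity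
  calc _ ≤ ∑ l ∈ Finset.range (k + 1) ∪ Finset.Ico k (k + K + 1), r ^ ((l - k) + (k - l)) :=
        Finset.sum_le_sum_of_subset_of_nonneg hsub (fun _ _ _ => hnn _)
    _ ≤ ∑ l ∈ Finset.range (k + 1), r ^ ((l - k) + (k - l)) +
        ∑ l ∈ Finset.Ico k (k + K + 1), r ^ ((l - k) + (k - l)) := by
        rw [← Finset.sum_union_inter]
        exact le_add_of_nonneg_right (Finset.sum_nonneg fun _ _ => hnn _)
    _ = ∑ l ∈ Finset.range (k + 1), r ^ l + ∑ l ∈ Finset.range (K + 1), r ^ l := by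
        congr 1
        · rw [← Finset.sum_range_reflect (fun i => r ^ i)]
          apply Finset.sum_congr rfl
          intro l hl
          simp at hl
          congr 1; omega
        · rw [Finset.sum_Ico_eq_sum_range]
          have : k + K + 1 - k = K + 1 := by omega
          rw [this]
          apply Finset.sum_congr rfl
          intro l hl
          congr 1; omega
    _ ≤ _ := by linarith [geo_le r hr0 hr1 (k + 1), geo_le r hr0 hr1 (K + 1)]

lemma VV_integrable (d K : ℕ) (c b : ℝ) : Integrable (VV d K) (volume.restrict (Set.Ico c b)) := by
  unfold VV
  exact (integrable_finsetSum _ fun k _ => integrable_finsetSum _ fun l _ => gg_int d k l c b).sub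
    (integrable_const _)

lemma PP_integrable (d k0 K : ℕ) (c b : ℝ) : Integrable (PP d k0 K) (volume.restrict (Set.Ico c b)) := by
  unfold PP
  exact integrable_finsetSum _ fun k _ => integrable_finsetSum _ fun l _ => gg_int d k l c b

lemma VV_integral (c : ℝ) (hc : 1 < c) (n : ℕ) (hcn : c < n) (K d : ℕ) (hd : 0 < d) :
    ∫ y, VV d K y ∂(volume.restrict (Set.Ico c n)) ≤ ((n + 1) * (2 * (1 / (1 - 1 / c)))) * K := by
  unfold VV
  rw [integral_sub (integrable_finsetSum _ fun k _ => integrable_finsetSum _ fun l _ => gg_int d k l c n)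
    (integrable_const _)]
  rw [integral_finsetSum _ (fun k _ => integrable_finsetSum _ fun l _ => gg_int d k l c n)]
  have h1 : ∀ k ∈ Finset.Icc 1 K, ∫ y, ∑ l ∈ Finset.Icc 1 K, gg d k l y ∂(volume.restrict (Set.Ico c n)) ≤
      K * ((n - c) / d) + (n + 1) * (2 * (1 / (1 - 1 / c))) := by
    intro k hk
    rw [integral_finsetSum _ (fun l _ => gg_int d k l c n)]
    have hr1 : 1 / c < 1 := by rw [div_lt_one (by linarith)]; exact hc
    calc _ ≤ ∑ l ∈ Finset.Icc 1 K, (((n:ℝ) - c) / d + (n + 1) * (1 / c) ^ ((l - k) + (k - l))) :=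
          Finset.sum_le_sum fun l hl => gg_bound c hc n hcn k l (Finset.mem_Icc.1 hk).1
            (Finset.mem_Icc.1 hl).1 d hd
      _ ≤ _ := by
          rw [Finset.sum_add_distrib, ← Finset.mul_sum]
          simp only [Finset.sum_const, Nat.card_Icc, Nat.add_sub_cancel, nsmul_eq_mul]
          gcongr
          exact geo2 (1 / c) (by positivity) hr1 k K
  have h2 := Finset.sum_le_sum h1
  simp only [Finset.sum_const, Nat.card_Icc, Nat.add_sub_cancel, nsmul_eq_mul] at h2
  rw [integral_const]
  simp only [measureReal_restrict_apply MeasurableSet.univ, Set.univ_inter, smul_eq_mul]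
  rw [Real.volume_real_Ico_of_le hcn.le]
  have e : (K:ℝ) * (K * ((n - c) / d) + (n + 1) * (2 * (1 / (1 - 1 / c)))) =
    ((n:ℝ) - c) * ((K:ℝ) ^ 2 / d) + ((n + 1) * (2 * (1 / (1 - 1 / c)))) * K := by ring
  linarith

lemma gg_far (c : ℝ) (hc : 1 < c) (n : ℕ) (hcn : c < n) (p k0 : ℕ) (hp : 1 ≤ p) (hnp : (n:ℝ) ≤ c ^ p)
    (hk0 : 1 ≤ k0) (hk0' : 1 ≤ c ^ k0 * (c - 1)) (K k l d : ℕ) (hK : 1 ≤ K) (hk : k0 ≤ k) (hkl : k < l)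
    (hd : K ^ (4 * p) < d) :
    ∫ y, gg d k l y ∂(volume.restrict (Set.Ico c n)) ≤ 4 * n / (K:ℝ) ^ 4 := by
  rw [gg_integral]
  have hc0 : 0 < c := by linarith
  have hK0 : (0:ℝ) < K := by exact_mod_cast hK
  have hK1 : (1:ℝ) ≤ K := by exact_mod_cast hK
  by_cases hne : {y ∈ Set.Ico c (n:ℝ) | (d : ℤ) ∣ ⌊y ^ l⌋ - ⌊y ^ k⌋}.Nonempty
  · obtain ⟨y, ⟨hy1, hy2⟩, hdvd⟩ := hne
    have hy0 : 0 < y := by linarith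
    have hyk : y ^ k + 1 ≤ y ^ l := by
      have h1 : y ^ (k + 1) ≤ y ^ l := pow_le_pow_right₀ (by linarith) (by omega)
      have h2 : c ^ k0 ≤ y ^ k := (pow_le_pow_left₀ hc0.le hy1 k0).trans
        (pow_le_pow_right₀ (by linarith) hk)
      have h3 : 0 < c ^ k0 := by positivity
      have h4 : 1 ≤ y ^ k * (y - 1) := hk0'.trans
        (mul_le_mul h2 (by linarith) (by linarith) (by positivity))
      rw [pow_succ] at h1
      linarith
    have hfl : ⌊y ^ k⌋ + 1 ≤ ⌊y ^ l⌋ := by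
      have := Int.floor_le_floor hyk
      rwa [Int.floor_add_one] at this
    have hle : (d:ℤ) ≤ ⌊y ^ l⌋ - ⌊y ^ k⌋ := Int.le_of_dvd (by omega) hdvd
    have hk0 : 0 ≤ ⌊y ^ k⌋ := Int.floor_nonneg.2 (by positivity)
    have hdl : (d:ℝ) ≤ y ^ l := by
      have h1 : (d:ℤ) ≤ ⌊y ^ l⌋ := by omega
      have h2 : ((d:ℤ):ℝ) ≤ ⌊y ^ l⌋ := by exact_mod_cast h1
      have := Int.floor_le (y ^ l)
      push_cast at h2
      linarith
    have hKc : (K:ℝ) ^ 4 < c ^ l := by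
      apply lt_of_pow_lt_pow_left₀ p (by positivity)
      calc ((K:ℝ) ^ 4) ^ p = ((K ^ (4 * p) : ℕ) : ℝ) := by push_cast; rw [pow_mul]
        _ < d := by exact_mod_cast hd
        _ ≤ y ^ l := hdl
        _ ≤ (c ^ p) ^ l := pow_le_pow_left₀ hy0.le (by linarith) l
        _ = (c ^ l) ^ p := by rw [← pow_mul, ← pow_mul, mul_comm]
    have hKd : (K:ℝ) ^ 4 ≤ d := by
      calc (K:ℝ) ^ 4 ≤ (K:ℝ) ^ (4 * p) := pow_le_pow_right₀ hK1 (by omega)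
        _ = ((K ^ (4 * p) : ℕ) : ℝ) := by push_cast; rfl
        _ ≤ d := by exact_mod_cast hd.le
    have hd0 : 0 < d := by omega
    refine (pairB c hc n hcn k l (by omega) hkl d hd0).trans ?_
    have b1 : ((n:ℝ) - c) / d ≤ (n - c) / (K:ℝ) ^ 4 := by
      apply div_le_div_of_nonneg_left (by linarith) (by positivity) hKd
    have b2 : 1 / c ^ (l - 1) ≤ c / (K:ℝ) ^ 4 := by
      rw [div_le_div_iff₀ (by positivity) (by positivity)]
      have : c * c ^ (l - 1) = c ^ l := by rw [← pow_succ']; congr 1; omega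
      linarith
    have e : ((n:ℝ) - c) / (K:ℝ) ^ 4 + c / (K:ℝ) ^ 4 = n / (K:ℝ) ^ 4 := by ring
    have e2 : 4 * (n:ℝ) / (K:ℝ) ^ 4 = 2 * (n / (K:ℝ) ^ 4) + 2 * (n / (K:ℝ) ^ 4) := by ring
    have : 0 ≤ (n:ℝ) / (K:ℝ) ^ 4 := by positivity
    linarith
  · rw [Set.not_nonempty_iff_eq_empty] at hne
    rw [hne]
    simp only [measureReal_empty]
    positivity

lemma PP_integral (c : ℝ) (hc : 1 < c) (n : ℕ) (hcn : c < n) (p k0 : ℕ) (hp : 1 ≤ p)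
    (hnp : (n:ℝ) ≤ c ^ p)
    (hk0 : 1 ≤ k0) (hk0' : 1 ≤ c ^ k0 * (c - 1)) (K d : ℕ) (hK : 1 ≤ K)
    (hd : K ^ (4 * p) < d) :
    ∫ y, PP d k0 K y ∂(volume.restrict (Set.Ico c n)) ≤ 4 * n / (K:ℝ) ^ 2 := by
  unfold PP
  have hK0 : (0:ℝ) < K := by exact_mod_cast hK
  rw [integral_finsetSum _ (fun k _ => integrable_finsetSum _ fun l _ => gg_int d k l c n)]
  have h1 : ∀ k ∈ Finset.Icc k0 K, ∫ y, ∑ l ∈ Finset.Ioc k K, gg d k l y ∂(volume.restrict (Set.Ico c n)) ≤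
      K * (4 * n / (K:ℝ) ^ 4) := by
    intro k hk
    rw [integral_finsetSum _ (fun l _ => gg_int d k l c n)]
    calc _ ≤ ∑ l ∈ Finset.Ioc k K, 4 * n / (K:ℝ) ^ 4 := Finset.sum_le_sum fun l hl =>
          gg_far c hc n hcn p k0 hp hnp hk0 hk0' K k l d hK (Finset.mem_Icc.1 hk).1
            (Finset.mem_Ioc.1 hl).1 hd
      _ ≤ _ := by
          simp only [Finset.sum_const, Nat.card_Ioc, nsmul_eq_mul]
          gcongr
          omega
  refine (Finset.sum_le_sum h1).trans ?_
  simp only [Finset.sum_const, Nat.card_Icc, nsmul_eq_mul]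
  calc _ ≤ (K:ℝ) * (K * (4 * n / (K:ℝ) ^ 4)) := by gcongr; omega
    _ = _ := by field_simp

lemma RR_integrable (K D N k0 : ℕ) (t c b : ℝ) :
    Integrable (RR K D N k0 t) (volume.restrict (Set.Ico c b)) := by
  unfold RR
  exact (integrable_finsetSum _ fun d _ => ((VV_integrable d K c b).div_const t).const_mul _).add
    (integrable_finsetSum _ fun d _ => (PP_integrable d k0 K c b).const_mul _)

lemma RR_integral (c : ℝ) (hc : 1 < c) (n : ℕ) (hcn : c < n) (p k0 : ℕ) (hp : 1 ≤ p)
    (hnp : (n:ℝ) ≤ c ^ p)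
    (hk0 : 1 ≤ k0) (hk0' : 1 ≤ c ^ k0 * (c - 1)) (K N : ℕ) (hK : 1 ≤ K) (t : ℝ) (ht : 0 < t) :
    ∫ y, RR K (K ^ (4 * p)) N k0 t y ∂(volume.restrict (Set.Ico c n)) ≤
      (((n + 1) * (2 * (1 / (1 - 1 / c)))) * K / t) * HH (K ^ (4 * p)) +
        (4 * n / (K:ℝ) ^ 2) * HH N := by
  unfold RR
  rw [integral_add (integrable_finsetSum _ fun d _ => ((VV_integrable d K c n).div_const t).const_mul _)
    (integrable_finsetSum _ fun d _ => (PP_integrable d k0 K c n).const_mul _)]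
  rw [integral_finsetSum _ fun d _ => ((VV_integrable d K c n).div_const t).const_mul _]
  rw [integral_finsetSum _ fun d _ => (PP_integrable d k0 K c n).const_mul _]
  apply add_le_add
  · unfold HH
    rw [Finset.mul_sum]
    apply Finset.sum_le_sum
    intro d hd
    rw [integral_const_mul, integral_div, mul_comm]
    have := VV_integral c hc n hcn K d (by simp at hd; omega)
    gcongr
  · calc _ ≤ ∑ d ∈ (Finset.Icc 1 N).filter (fun d => K ^ (4 * p) < d), (4 * n / (K:ℝ) ^ 2) * (1 / (d:ℝ)) := by
          apply Finset.sum_le_sum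
          intro d hd
          rw [integral_const_mul, mul_comm]
          have := PP_integral c hc n hcn p k0 hp hnp hk0 hk0' K d hK (Finset.mem_filter.1 hd).2
          gcongr
      _ ≤ _ := by
          unfold HH
          rw [Finset.mul_sum]
          exact Finset.sum_le_sum_of_subset_of_nonneg (Finset.filter_subset _ _) (fun _ _ _ => by positivity)

lemma idx_finite (N d a : ℕ) (y : ℝ) : {k : ℕ | 1 ≤ k ∧ (k : ℝ) ≤ Real.log N / Real.log y ∧
    ⌊y ^ k⌋ ≡ (a : ℤ) [ZMOD (d : ℤ)]}.Finite := by
  apply (Set.finite_Iic ⌊Real.log N / Real.log y⌋₊).subset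
  rintro k ⟨_, h, _⟩
  exact Nat.le_floor h

lemma cnt_mono (N N' d a : ℕ) (y : ℝ) (hy : 1 < y) (hN : 1 ≤ N) (h : N ≤ N') :
    cnt N d a y ≤ cnt N' d a y := by
  unfold cnt
  rw [Nat.card_coe_set_eq, Nat.card_coe_set_eq]
  apply Set.ncard_le_ncard _ (idx_finite N' d a y)
  rintro k ⟨h1, h2, h3⟩
  refine ⟨h1, h2.trans ?_, h3⟩
  have : 0 < Real.log y := Real.log_pos hy
  have hN0 : (0:ℝ) < N := by exact_mod_cast hN
  gcongr

lemma fN_mono (N N' : ℕ) (y : ℝ) (hy : 1 < y) (hN : 1 ≤ N) (h : N ≤ N') : fN N y ≤ fN N' y := by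
  unfold fN
  calc _ ≤ ∑ d ∈ Finset.Icc 1 N, (1 / (d : ℝ)) * (((Finset.Icc 1 d).sup (fun a => cnt N' d a y) : ℕ) : ℝ) := by
        apply Finset.sum_le_sum
        intro d _
        have : (Finset.Icc 1 d).sup (fun a => cnt N d a y) ≤ (Finset.Icc 1 d).sup (fun a => cnt N' d a y) :=
          Finset.sup_mono_fun fun a _ => cnt_mono N N' d a y hy hN h
        gcongr
    _ ≤ _ := Finset.sum_le_sum_of_subset_of_nonneg (Finset.Icc_subset_Icc le_rfl h)
        (fun _ _ _ => by positivity)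

lemma f_lt_top (y C : ℝ) (hy : 1 < y) (hC : 0 ≤ C)
    (h : ∀ j : ℕ, fN (2 ^ (4 ^ j)) y ≤ C * 4 ^ j) : f y < ⊤ := by
  have hl2 : 0 < Real.log 2 := Real.log_pos (by norm_num)
  have key : ∀ N : ℕ, 2 ≤ N → fN N y / Real.log N ≤ 4 * C / Real.log 2 := by
    intro N hN
    have hex : ∃ j : ℕ, N ≤ 2 ^ (4 ^ j) := ⟨N, by
      have h1 : N < 2 ^ N := Nat.lt_two_pow_self
      have h2 : N < 4 ^ N := Nat.lt_pow_self (by norm_num)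
      exact h1.le.trans (Nat.pow_le_pow_right (by norm_num) h2.le)⟩
    classical
    have hj := Nat.find_spec hex
    have hmin := fun m => Nat.find_min hex (m := m)
    set j := Nat.find hex
    have h1 : fN N y ≤ C * 4 ^ j := (fN_mono N _ y hy (by omega) hj).trans (h j)
    have hN2 : (2:ℝ) ≤ N := by exact_mod_cast hN
    have hlN : 0 < Real.log N := Real.log_pos (by linarith)
    rw [div_le_div_iff₀ hlN hl2]
    have h2 : (4:ℝ) ^ j * Real.log 2 ≤ 4 * Real.log N := by
      rcases Nat.eq_zero_or_pos j with h0 | h0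
      · rw [h0, pow_zero, one_mul]
        have := Real.log_le_log (by norm_num) hN2
        linarith
      · obtain ⟨i, hi⟩ : ∃ i, j = i + 1 := ⟨j - 1, by omega⟩
        have h3 := hmin i (by omega)
        push Not at h3
        have h4 : ((2:ℝ) ^ (4 ^ i)) ≤ N := by exact_mod_cast h3.le
        have h5 := Real.log_le_log (by positivity) h4
        rw [Real.log_pow] at h5
        push_cast at h5
        rw [hi, pow_succ]
        linarith
    calc fN N y * Real.log 2 ≤ (C * 4 ^ j) * Real.log 2 := by gcongr
      _ = C * (4 ^ j * Real.log 2) := by ring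
      _ ≤ C * (4 * Real.log N) := by gcongr
      _ = _ := by ring
  unfold f
  refine lt_of_le_of_lt (b := ENNReal.ofReal (4 * C / Real.log 2)) ?_ ENNReal.ofReal_lt_top
  apply Filter.limsup_le_of_le
  · isBoundedDefault
  · filter_upwards [eventually_ge_atTop 2] with N hN
    exact ENNReal.ofReal_le_ofReal (key N hN)

lemma main_ae (c : ℝ) (hc : 1 < c) (n : ℕ) (hn : 3 ≤ n) (hcn : c < n) :
    ∀ᵐ y ∂(volume.restrict (Set.Ico c (n:ℝ))), f y < ⊤ := by
  have hc0 : 0 < c := by linarith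
  obtain ⟨p, hp⟩ := pow_unbounded_of_one_lt (n:ℝ) hc
  have hn3 : (3:ℝ) ≤ n := by exact_mod_cast hn
  have hp1 : 1 ≤ p := by
    by_contra h
    have : p = 0 := by omega
    subst this
    norm_num at hp
    linarith
  obtain ⟨k0, hk0⟩ := pow_unbounded_of_one_lt (1 / (c - 1)) hc
  have hk0' : 1 ≤ c ^ (k0 + 1) * (c - 1) := by
    rw [div_lt_iff₀ (by linarith)] at hk0
    have : c ^ k0 ≤ c ^ (k0 + 1) := pow_le_pow_right₀ hc.le (by omega)
    nlinarith
  set K : ℕ → ℕ := fun j => p * 4 ^ j with hKdef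
  set R : ℕ → ℝ → ℝ := fun j => RR (K j) (K j ^ (4 * p)) (2 ^ (4 ^ j)) (k0 + 1) (2 ^ j) with hR
  have hp0 : (1:ℝ) ≤ p := by exact_mod_cast hp1
  have hK1 : ∀ j, 1 ≤ K j := fun j => Nat.mul_pos hp1 (by positivity)
  have hlog2 : Real.log 2 ≤ 1 := by linarith [Real.log_le_sub_one_of_pos (show (0:ℝ) < 2 by norm_num)]
  have hHD : ∀ j, HH (K j ^ (4 * p)) ≤ 1 + 4 * p * (p + 2 * j) := by
    intro j
    refine (HH_le _).trans ?_
    push_cast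
    rw [Real.log_pow]
    have : Real.log (K j) ≤ p + 2 * j := by
      rw [hKdef]; push_cast
      rw [Real.log_mul (by positivity) (by positivity), Real.log_pow]
      have h1 : Real.log p ≤ p := by linarith [Real.log_le_sub_one_of_pos (show (0:ℝ) < p by linarith)]
      have h2 : Real.log 4 = 2 * Real.log 2 := by
        rw [show (4:ℝ) = 2 ^ 2 by norm_num, Real.log_pow]; norm_num
      rw [h2]
      have : (j:ℝ) * (2 * Real.log 2) ≤ j * (2 * 1) := by gcongr
      linarith
    push_cast
    gcongr
  have hHN : ∀ j, HH (2 ^ (4 ^ j)) ≤ 2 * 4 ^ j := by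
    intro j
    refine (HH_le _).trans ?_
    push_cast
    rw [Real.log_pow]
    push_cast
    have h1 : (1:ℝ) ≤ 4 ^ j := one_le_pow₀ (by norm_num)
    have : (4:ℝ) ^ j * Real.log 2 ≤ 4 ^ j * 1 := by gcongr
    linarith
  set Q : ℝ := (n + 1) * (2 * (1 / (1 - 1 / c))) with hQ
  have hQ0 : 0 ≤ Q := by
    have : 1 / c < 1 := by rw [div_lt_one hc0]; exact hc
    have : 0 < 1 - 1 / c := by linarith
    positivity
  set u : ℕ → ℝ := fun j => Q * p * ((1 + 4 * p * p) * (1 / 2) ^ j + 8 * p * (j * (1 / 2) ^ j)) + 8 * n * (1 / 4) ^ j with hu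
  have hint : ∀ j, ∫ y, R j y / 4 ^ j ∂(volume.restrict (Set.Ico c (n:ℝ))) ≤ u j := by
    intro j
    rw [integral_div]
    have h := RR_integral c hc n hcn p (k0 + 1) hp1 hp.le (by omega) hk0' (K j) (2 ^ (4 ^ j)) (hK1 j)
      (2 ^ j) (by positivity)
    rw [div_le_iff₀ (by positivity)]
    refine h.trans ?_
    have hKr : (K j : ℝ) = p * 4 ^ j := by rw [hKdef]; push_cast; ring
    have e4 : (4:ℝ) ^ j = 2 ^ j * 2 ^ j := by rw [← mul_pow]; norm_num
    have b1 : (Q * K j / 2 ^ j) * HH (K j ^ (4 * p)) ≤ (Q * p * 2 ^ j) * (1 + 4 * p * (p + 2 * j)) := by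
      have : Q * K j / 2 ^ j = Q * p * 2 ^ j := by
        rw [hKr, e4]; field_simp
      rw [this]
      gcongr
      exact hHD j
    have b2 : (4 * n / (K j : ℝ) ^ 2) * HH (2 ^ (4 ^ j)) ≤ 8 * n := by
      have hKj : (1:ℝ) ≤ K j := by exact_mod_cast hK1 j
      have h4K : (4:ℝ) ^ j ≤ K j := by rw [hKr]; nlinarith [show (0:ℝ) < 4 ^ j by positivity]
      calc _ ≤ (4 * n / (K j : ℝ) ^ 2) * (2 * K j) := by
            gcongr
            exact (hHN j).trans (by linarith)
        _ = 8 * n / K j := by field_simp; ring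
        _ ≤ 8 * n := div_le_self (by positivity) hKj
    have e : u j * 4 ^ j = (Q * p * 2 ^ j) * (1 + 4 * p * (p + 2 * j)) + 8 * n := by
      rw [hu]
      simp only
      have e1 : ((1:ℝ) / 2) ^ j * 4 ^ j = 2 ^ j := by rw [← mul_pow]; norm_num
      have e2 : ((1:ℝ) / 4) ^ j * 4 ^ j = 1 := by rw [← mul_pow]; norm_num
      calc _ = Q * p * ((1 + 4 * p * p) * ((1 / 2) ^ j * 4 ^ j) + 8 * p * (j * ((1 / 2) ^ j * 4 ^ j)))
            + 8 * n * ((1 / 4) ^ j * 4 ^ j) := by ring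
        _ = _ := by rw [e1, e2]; ring
    rw [e]
    exact add_le_add b1 b2
  have husum : Summable u := by
    rw [hu]
    have s1 : Summable fun j : ℕ => ((1:ℝ) / 2) ^ j := summable_geometric_of_lt_one (by norm_num) (by norm_num)
    have s2 : Summable fun j : ℕ => ((1:ℝ) / 4) ^ j := summable_geometric_of_lt_one (by norm_num) (by norm_num)
    have s3 : Summable fun j : ℕ => (j:ℝ) * ((1:ℝ) / 2) ^ j := by
      have := summable_pow_mul_geometric_of_norm_lt_one (R := ℝ) 1 (r := 1 / 2) (by norm_num)
      simpa using this
    exact (((s1.mul_left _).add (s3.mul_left _)).mul_left _).add (s2.mul_left _)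
  have hRnn : ∀ j y, 0 ≤ R j y / 4 ^ j := fun j y =>
    div_nonneg (RR_nonneg _ _ _ _ _ (by positivity) y) (by positivity)
  have hRint : ∀ j, Integrable (fun y => R j y / 4 ^ j) (volume.restrict (Set.Ico c (n:ℝ))) := fun j =>
    (RR_integrable _ _ _ _ _ _ _).div_const _
  have hmeas : ∀ j, AEMeasurable (fun y => ENNReal.ofReal (R j y / 4 ^ j)) (volume.restrict (Set.Ico c (n:ℝ))) :=
    fun j => (hRint j).aemeasurable.ennreal_ofReal
  have hlint : ∫⁻ y, ∑' j, ENNReal.ofReal (R j y / 4 ^ j) ∂(volume.restrict (Set.Ico c (n:ℝ))) ≠ ⊤ := by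
    rw [lintegral_tsum hmeas]
    have hle : ∀ j, ∫⁻ y, ENNReal.ofReal (R j y / 4 ^ j) ∂(volume.restrict (Set.Ico c (n:ℝ))) ≤
        ENNReal.ofReal (u j) := by
      intro j
      rw [← ofReal_integral_eq_lintegral_ofReal (hRint j) (Eventually.of_forall (hRnn j))]
      exact ENNReal.ofReal_le_ofReal (hint j)
    exact ne_top_of_le_ne_top husum.tsum_ofReal_ne_top (ENNReal.tsum_le_tsum hle)
  have hae := ae_lt_top' (AEMeasurable.tsum hmeas) hlint
  filter_upwards [hae, ae_restrict_mem measurableSet_Ico] with y hy hyI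
  have hy1 : 1 < y := lt_of_lt_of_le hc hyI.1
  set B := (∑' j, ENNReal.ofReal (R j y / 4 ^ j)).toReal with hB
  have hRB : ∀ j, R j y ≤ B * 4 ^ j := by
    intro j
    have h1 := ENNReal.toReal_mono hy.ne (ENNReal.le_tsum (f := fun j => ENNReal.ofReal (R j y / 4 ^ j)) j)
    rw [ENNReal.toReal_ofReal (hRnn j y)] at h1
    rwa [div_le_iff₀ (by positivity)] at h1
  have hB0 : 0 ≤ B := ENNReal.toReal_nonneg
  apply f_lt_top y (2 * p + (1 + 4 * p * (p + 2)) + ((k0 + 1 : ℕ) + 1) * 2 + B) hy1 (by positivity)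
  intro j
  have hK : Real.log ((2 ^ (4 ^ j) : ℕ) : ℝ) / Real.log y ≤ K j := by
    have hly : 0 < Real.log y := Real.log_pos hy1
    rw [div_le_iff₀ hly]
    push_cast
    rw [Real.log_pow, hKdef]
    push_cast
    have h1 : Real.log 2 ≤ p * Real.log y := by
      rw [← Real.log_pow]
      apply Real.log_le_log (by norm_num)
      have : c ^ p ≤ y ^ p := pow_le_pow_left₀ hc0.le hyI.1 p
      linarith
    calc (4:ℝ) ^ j * Real.log 2 ≤ 4 ^ j * (p * Real.log y) := by gcongr
      _ = _ := by ring
  have h := fN_le (2 ^ (4 ^ j)) (K j) (K j ^ (4 * p)) (k0 + 1) (2 ^ j) y (by positivity) hK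
  refine h.trans ?_
  have hKr : (K j : ℝ) = p * 4 ^ j := by rw [hKdef]; push_cast; ring
  have e4 : (4:ℝ) ^ j = 2 ^ j * 2 ^ j := by rw [← mul_pow]; norm_num
  have hj2 : (j:ℝ) ≤ 2 ^ j := by exact_mod_cast (Nat.lt_two_pow_self (n := j)).le
  have h12 : (1:ℝ) ≤ 2 ^ j := one_le_pow₀ (by norm_num)
  have t1 : (2:ℝ) ^ j * HH (K j ^ (4 * p)) ≤ (1 + 4 * p * (p + 2)) * 4 ^ j := by
    calc _ ≤ (2:ℝ) ^ j * (1 + 4 * p * (p + 2 * j)) := by gcongr; exact hHD j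
      _ ≤ (2:ℝ) ^ j * (2 ^ j * 1 + 4 * p * (p * 2 ^ j + 2 * 2 ^ j)) := by
          gcongr
          · linarith
          · nlinarith
      _ = _ := by rw [e4]; ring
  have t2 : (((k0 + 1 : ℕ) : ℝ) + 1) * HH (2 ^ (4 ^ j)) ≤ (((k0 + 1 : ℕ) : ℝ) + 1) * (2 * 4 ^ j) := by
    gcongr; exact hHN j
  have t3 := hRB j
  rw [hKr]
  have : (2 * (p:ℝ) + (1 + 4 * p * (p + 2)) + ((k0 + 1 : ℕ) + 1) * 2 + B) * 4 ^ j =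
    2 * (p * 4 ^ j) + (1 + 4 * p * (p + 2)) * 4 ^ j + ((k0 + 1 : ℕ) + 1) * (2 * 4 ^ j) + B * 4 ^ j := by ring
  rw [this]
  exact add_le_add (add_le_add (add_le_add le_rfl t1) t2) t3

lemma cnt_meas (N d a : ℕ) : Measurable (cnt N d a) := by
  have hset : ∀ k : ℕ, MeasurableSet {y : ℝ | 1 ≤ k ∧ (k : ℝ) ≤ Real.log N / Real.log y ∧
      ⌊y ^ k⌋ ≡ (a : ℤ) [ZMOD (d : ℤ)]} := by
    intro k
    have h1 : Measurable fun y : ℝ => Real.log N / Real.log y := Real.measurable_log.const_div _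
    have h2 : Measurable fun y : ℝ => ⌊y ^ k⌋ := (measurable_id.pow_const k).floor
    apply (MeasurableSet.const _).inter
    apply MeasurableSet.inter (measurableSet_le measurable_const h1)
    exact h2 (MeasurableSet.of_discrete (s := {z : ℤ | z ≡ (a : ℤ) [ZMOD (d : ℤ)]}))
  have e : ∀ y, cnt N d a y = (∑' k : ℕ, Set.indicator {y : ℝ | 1 ≤ k ∧ (k : ℝ) ≤ Real.log N / Real.log y ∧
      ⌊y ^ k⌋ ≡ (a : ℤ) [ZMOD (d : ℤ)]} (fun _ => (1:ENNReal)) y).toNNReal := by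
    intro y
    have hfin := idx_finite N d a y
    unfold cnt
    set S := {k : ℕ | 1 ≤ k ∧ (k : ℝ) ≤ Real.log N / Real.log y ∧
      ⌊y ^ k⌋ ≡ (a : ℤ) [ZMOD (d : ℤ)]} with hS
    have : ∀ k : ℕ, Set.indicator {y : ℝ | 1 ≤ k ∧ (k : ℝ) ≤ Real.log N / Real.log y ∧
      ⌊y ^ k⌋ ≡ (a : ℤ) [ZMOD (d : ℤ)]} (fun _ => (1:ENNReal)) y = S.indicator (fun _ => 1) k := by
      intro k
      by_cases hk : k ∈ S
      · rw [Set.indicator_of_mem hk, Set.indicator_of_mem]; exact hk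
      · rw [Set.indicator_of_notMem hk, Set.indicator_of_notMem]; exact hk
    simp only [this]
    rw [← tsum_subtype S (fun _ => (1:ENNReal)), ENNReal.tsum_set_one, Nat.card_coe_set_eq,
      ← hfin.cast_ncard_eq]
    simp
  have hm : Measurable fun y => (cnt N d a y : NNReal) := by
    simp only [e]
    apply Measurable.ennreal_toNNReal
    exact Measurable.tsum fun k => measurable_const.indicator (hset k)
  have : cnt N d a = fun y => ⌊(cnt N d a y : NNReal)⌋₊ := by ext y; simp
  rw [this]
  exact hm.nat_floor

lemma f_meas : Measurable f := by
  unfold f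
  apply Measurable.limsup
  intro N
  apply Measurable.ennreal_ofReal
  apply Measurable.div_const
  unfold fN
  apply Finset.measurable_fun_sum
  intro d _
  apply Measurable.const_mul
  have : Measurable fun y => (Finset.Icc 1 d).sup (fun a => cnt N d a y) :=
    by
      have h := Finset.induction_on (motive := fun s : Finset ℕ => Measurable fun y => s.sup (fun a => cnt N d a y))
        (Finset.Icc 1 d) (by simp) (by
          intro a s _ ih
          simp only [Finset.sup_insert]
          exact (cnt_meas N d a).sup ih)
      exact h
  exact (measurable_from_top (f := fun m : ℕ => (m : ℝ))).comp this

lemma Ln_meas (n : ℕ) : MeasurableSet (Ln n) := by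
  apply MeasurableSet.diff measurableSet_Ioo
  apply MeasurableSet.biUnion (Set.to_countable _)
  intro N _
  apply MeasurableSet.inter measurableSet_Ioo
  have : {y : ℝ | ∃ k : ℕ, 1 ≤ k ∧ (k : ℝ) ≤ Real.log N / Real.log y ∧ ∃ m : ℤ, y ^ k = (m : ℝ)} =
      ⋃ k : ℕ, {y : ℝ | 1 ≤ k} ∩ ({y : ℝ | (k : ℝ) ≤ Real.log N / Real.log y} ∩
        ⋃ m : ℤ, {y : ℝ | y ^ k = (m : ℝ)}) := by
    ext y; simp
  have h : MeasurableSet {y : ℝ | ∃ k : ℕ, 1 ≤ k ∧ (k : ℝ) ≤ Real.log N / Real.log y ∧ ∃ m : ℤ, y ^ k = (m : ℝ)} := by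
    rw [this]
    refine MeasurableSet.iUnion fun k => (MeasurableSet.const _).inter (MeasurableSet.inter ?_ ?_)
    · exact measurableSet_le measurable_const (Real.measurable_log.const_div _)
    · exact MeasurableSet.iUnion fun m => measurableSet_eq_fun (measurable_id.pow_const k) measurable_const
  exact h

/-- For an integer `n ≥ 3`, the set `𝒟_n = {y ∈ ℒ_n : f(y) = ∞}` is Lebesgue
measurable and has Lebesgue measure zero. -/
theorem stmt9 (n : ℕ) (hn : 3 ≤ n) :
    MeasurableSet {y ∈ Ln n | f y = ⊤} ∧ volume {y ∈ Ln n | f y = ⊤} = 0 := by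
  refine ⟨(Ln_meas n).inter (f_meas (measurableSet_singleton ⊤)), ?_⟩
  have hn3 : (3:ℝ) ≤ n := by exact_mod_cast hn
  have hc : 1 < 1 + 1 / (n:ℝ) := by
    have : 0 < 1 / (n:ℝ) := by positivity
    linarith
  have hcn : 1 + 1 / (n:ℝ) < n := by
    have : 1 / (n:ℝ) ≤ 1 := by rw [div_le_one (by linarith)]; linarith
    linarith
  have h := main_ae (1 + 1 / (n:ℝ)) hc n hn hcn
  rw [ae_restrict_iff' measurableSet_Ico] at h
  refine measure_mono_null ?_ (ae_iff.1 h)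
  rintro y ⟨hy, hf⟩
  have hy' : y ∈ Set.Ioo (1 + 1 / (n:ℝ)) (n:ℝ) := hy.1
  intro hcon
  exact (hcon ⟨hy'.1.le, hy'.2⟩).ne hf
end
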